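/- arXiv:0902.1470 — 2 statements merged into one kernel-verified Lean document; each statement's English description precedes it below -/
import Mathlib

section
/- Let S be a semitransitive subsemigroup of the singular part I_n \ S_n with |S| ≤ 2n, let g and h be two distinct non-zero idempotents of S, and let S' = gSg ∪ gSh ∪ hSg ∪ hSh (where eSf = {e·σ·f : σ ∈ S}). If φ ∈ S' is nilpotent and x is in the domain of φ, then there is no ψ ∈ S with ψ(φ(x)) = x; that is, φ(x) lies in a strictly lower transitivity block than x (a nilpotent element of S' has no arrow from a block to itself). -/
/-- `ISemi n` is the symmetric inverse semigroup `I_n`, realized as the set of all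
partial injective maps (partial permutations) of the `n`-element set `Fin n`,
with composition given by `PEquiv.trans` (apply the left factor first, matching
the right-action convention `x φ`). -/
abbrev ISemi (n : ℕ) := PEquiv (Fin n) (Fin n)

/-- `S` is a subsemigroup of `I_n`: a subset closed under composition. -/
def IsSubsemigroup {n : ℕ} (S : Set (ISemi n)) : Prop :=
  ∀ a ∈ S, ∀ b ∈ S, a.trans b ∈ S

/-- `φ` belongs to the singular part `I_n \ S_n`: its domain is a proper subset
of the underlying set, i.e. it is undefined somewhere. -/
def IsSingular {n : ℕ} (φ : ISemi n) : Prop :=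
  ∃ x : Fin n, φ x = none

/-- `S` is semitransitive: for all `x, y` there is `φ ∈ S` with `φ x = y` or `φ y = x`. -/
def Semitransitive {n : ℕ} (S : Set (ISemi n)) : Prop :=
  ∀ x y : Fin n, ∃ φ ∈ S, φ x = some y ∨ φ y = some x

/-- The semitransitivity preorder induced by `S`: `x ≥ y` iff some `φ ∈ S` maps `x` to `y`. -/
def STGe {n : ℕ} (S : Set (ISemi n)) (x y : Fin n) : Prop :=
  ∃ φ ∈ S, φ x = some y

/-- The transitivity block of `x`: the equivalence class of `x` under `x ≥ y ∧ y ≥ x`. -/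
def STBlock {n : ℕ} (S : Set (ISemi n)) (x : Fin n) : Set (Fin n) :=
  {y | STGe S x y ∧ STGe S y x}

/-- `k`-th power of `φ` under composition (`pePow φ 0` is the identity). -/
def pePow {n : ℕ} (φ : ISemi n) : ℕ → ISemi n
  | 0 => PEquiv.refl (Fin n)
  | k + 1 => (pePow φ k).trans φ

section PartialIdentities

variable {n : ℕ} {S : Set (ISemi n)}

lemma trans_eq_some {α β : ISemi n} {a c : Fin n} :
    α.trans β a = some c ↔ ∃ b, α a = some b ∧ β b = some c := by
  have := PEquiv.mem_trans α β a c
  simpa [Option.mem_def] using this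

lemma pequiv_inj_some {α : ISemi n} {a b c : Fin n} (h₁ : α a = some c) (h₂ : α b = some c) :
    a = b :=
  α.inj h₁ h₂

/-- A partial identity; these are exactly the idempotents of `I_n`. -/
def IsPartialId (f : ISemi n) : Prop := ∀ a b, f a = some b → a = b

lemma IsPartialId.of_trans_self {f : ISemi n} (hf : f.trans f = f) : IsPartialId f := by
  intro a b hab
  have h := hab
  rw [← hf, trans_eq_some] at h
  obtain ⟨c, hc, hcb⟩ := h
  have hbc : b = c := Option.some.inj (hab.symm.trans hc)
  exact pequiv_inj_some hab (hbc ▸ hcb)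

lemma IsPartialId.trans {e f : ISemi n} (he : IsPartialId e) (hf : IsPartialId f) :
    IsPartialId (e.trans f) := by
  intro a c h
  obtain ⟨b, hab, hbc⟩ := trans_eq_some.1 h
  exact (he _ _ hab).trans (hf _ _ hbc)

lemma IsPartialId.trans_eq_some_self {e f : ISemi n} (he : IsPartialId e) {a : Fin n} :
    e.trans f a = some a ↔ e a = some a ∧ f a = some a := by
  rw [trans_eq_some]
  constructor
  · rintro ⟨b, hab, hb⟩
    obtain rfl := he _ _ hab
    exact ⟨hab, hb⟩
  · rintro ⟨h₁, h₂⟩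
    exact ⟨a, h₁, h₂⟩

lemma IsPartialId.ext {e f : ISemi n} (he : IsPartialId e) (hf : IsPartialId f)
    (h : ∀ a, e a = some a ↔ f a = some a) : e = f := by
  apply PEquiv.ext
  intro a
  apply Option.ext
  intro b
  constructor
  · intro hb
    obtain rfl := he _ _ hb
    exact (h a).1 hb
  · intro hb
    obtain rfl := hf _ _ hb
    exact (h a).2 hb

lemma pePow_add (α : ISemi n) (a b : ℕ) : pePow α (a + b) = (pePow α a).trans (pePow α b) := by
  induction b with
  | zero => simp [pePow]
  | succ b ih => rw [← Nat.add_assoc, pePow, ih, pePow, PEquiv.trans_assoc]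

lemma pePow_mem (hsub : IsSubsemigroup S) {α : ISemi n} (hα : α ∈ S) (k : ℕ) :
    pePow α (k + 1) ∈ S := by
  induction k with
  | zero => simpa [pePow] using hα
  | succ k ih => exact hsub _ ih _ hα

instance : Finite (ISemi n) := Finite.of_injective _ (DFunLike.coe_injective (F := ISemi n))

lemma exists_isPartialId_pePow (α : ISemi n) : ∃ k, IsPartialId (pePow α (k + 2)) := by
  obtain ⟨a, b, hab, heq⟩ :=
    Finite.exists_ne_map_eq_of_infinite (fun k : ℕ => pePow α (k + 2))
  wlog hlt : a < b generalizing a b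
  · exact this b a hab.symm heq.symm (by omega)
  obtain ⟨p, rfl⟩ := Nat.exists_eq_add_of_lt hlt
  have hstep (c : ℕ) : pePow α (a + 2 + c + (p + 1)) = pePow α (a + 2 + c) := by
    rw [pePow_add α (a + 2) c, show pePow α (a + 2) = pePow α (a + p + 1 + 2) from heq,
      ← pePow_add]
    congr 1
    omega
  have hmul (c m : ℕ) : pePow α (a + 2 + c + m * (p + 1)) = pePow α (a + 2 + c) := by
    induction m with
    | zero => simp
    | succ m ih =>
      rw [← ih, show a + 2 + c + (m + 1) * (p + 1) = a + 2 + (c + m * (p + 1)) + (p + 1) by ring,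
        hstep, ← Nat.add_assoc]
  refine ⟨(a + 2) * (p + 1) - 2, IsPartialId.of_trans_self ?_⟩
  have h₁ : (a + 2) * (p + 1) = a + 2 + (a + 2) * p := by ring
  have h₂ : (a + 2) * (p + 1) - 2 + 2 = a + 2 + (a + 2) * p := by omega
  rw [h₂, ← pePow_add]
  conv_lhs => rw [← h₁]
  conv_rhs => rw [← hmul _ (a + 2)]
  congr 1
  omega

lemma pePow_eq_some_self {α : ISemi n} {x : Fin n} (h : α x = some x) (k : ℕ) :
    pePow α k x = some x := by
  induction k with
  | zero => rfl
  | succ k ih => exact trans_eq_some.2 ⟨x, ih, h⟩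

/-- An element of `S` with an arrow inside a block has a partial inverse in `S`. -/
lemma exists_return (hsub : IsSubsemigroup S) {φ : ISemi n} (hφ : φ ∈ S) {x y : Fin n}
    (hxy : φ x = some y) (hyx : STGe S y x) :
    ∃ ρ ∈ S, ρ y = some x ∧ IsPartialId (φ.trans ρ) := by
  obtain ⟨ψ, hψ, hψyx⟩ := hyx
  have hφψ : φ.trans ψ ∈ S := hsub _ hφ _ hψ
  have hx : φ.trans ψ x = some x := trans_eq_some.2 ⟨y, hxy, hψyx⟩
  obtain ⟨k, hk⟩ := exists_isPartialId_pePow (φ.trans ψ)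
  refine ⟨ψ.trans (pePow (φ.trans ψ) (k + 1)), hsub _ hψ _ (pePow_mem hsub hφψ k),
    trans_eq_some.2 ⟨x, hψyx, pePow_eq_some_self hx _⟩, ?_⟩
  have h1 : pePow (φ.trans ψ) 1 = φ.trans ψ := by simp [pePow]
  rw [show k + 2 = 1 + (k + 1) by omega, pePow_add, h1, PEquiv.trans_assoc] at hk
  exact hk

/-- Every point has a least partial identity of `S` fixing it. -/
lemma exists_least_partialId (hsub : IsSubsemigroup S) (hst : Semitransitive S) (x : Fin n) :
    ∃ e ∈ S, IsPartialId e ∧ e x = some x ∧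
      ∀ f ∈ S, IsPartialId f → f x = some x → e.trans f = e ∧ f.trans e = e := by
  classical
  let A : Set (ISemi n) := {e | e ∈ S ∧ IsPartialId e ∧ e x = some x}
  have hA : A.Nonempty := by
    obtain ⟨α, hα, hx⟩ := hst x x
    rw [or_self] at hx
    obtain ⟨k, hk⟩ := exists_isPartialId_pePow α
    exact ⟨_, pePow_mem hsub hα (k + 1), hk, pePow_eq_some_self hx _⟩
  obtain ⟨e, ⟨heS, he, hex⟩, hmin⟩ := Set.exists_min_image A
    (fun e => (Finset.univ.filter fun a => e a = some a).card) A.toFinite hA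
  refine ⟨e, heS, he, hex, fun f hfS hf hfx => ?_⟩
  have hle := hmin (e.trans f)
    ⟨hsub _ heS _ hfS, he.trans hf, he.trans_eq_some_self.2 ⟨hex, hfx⟩⟩
  have heq := Finset.eq_of_subset_of_card_le (fun a ha => by
    simp only [Finset.mem_filter, Finset.mem_univ, true_and] at ha ⊢
    exact (he.trans_eq_some_self.1 ha).1) hle
  have hfix (a : Fin n) (ha : e a = some a) : f a = some a := by
    have : a ∈ Finset.univ.filter fun a => e.trans f a = some a := by simp [heq, ha]
    simp only [Finset.mem_filter, Finset.mem_univ, true_and] at this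
    exact (he.trans_eq_some_self.1 this).2
  constructor
  · exact (he.trans hf).ext he fun a => by
      rw [he.trans_eq_some_self]
      exact ⟨And.left, fun h => ⟨h, hfix a h⟩⟩
  · exact (hf.trans he).ext he fun a => by
      rw [hf.trans_eq_some_self]
      exact ⟨And.right, fun h => ⟨hfix a h, h⟩⟩

end PartialIdentities

section CoFixed

variable {n : ℕ} {S : Set (ISemi n)}

/-- Two points are co-fixed when the same partial identities of `S` fix them. -/
def CoFixed (S : Set (ISemi n)) (x w : Fin n) : Prop :=
  ∀ f ∈ S, IsPartialId f → (f x = some x ↔ f w = some w)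

lemma CoFixed.refl (x : Fin n) : CoFixed S x x := fun _ _ _ => Iff.rfl

lemma CoFixed.symm {x w : Fin n} (h : CoFixed S x w) : CoFixed S w x :=
  fun f hf hfid => (h f hf hfid).symm

lemma CoFixed.trans {x w z : Fin n} (h : CoFixed S x w) (h' : CoFixed S w z) : CoFixed S x z :=
  fun f hf hfid => (h f hf hfid).trans (h' f hf hfid)

/-- Arrows inside a block carry co-fixed points to co-fixed points. -/
lemma CoFixed.map (hsub : IsSubsemigroup S) {φ : ISemi n} (hφ : φ ∈ S) {x y w : Fin n}
    (hxy : φ x = some y) (hyx : STGe S y x) (hw : CoFixed S x w) :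
    ∃ v, φ w = some v ∧ CoFixed S y v := by
  obtain ⟨ρ, hρ, hρy, hid⟩ := exists_return hsub hφ hxy hyx
  have hφw : φ.trans ρ w = some w :=
    (hw _ (hsub _ hφ _ hρ) hid).1 (trans_eq_some.2 ⟨y, hxy, hρy⟩)
  obtain ⟨v, hv, hρv⟩ := trans_eq_some.1 hφw
  refine ⟨v, hv, fun f hf hfid => ?_⟩
  have hmem : φ.trans (f.trans ρ) ∈ S := hsub _ hφ _ (hsub _ hf _ hρ)
  have hpid : IsPartialId (φ.trans (f.trans ρ)) := by
    intro a c h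
    obtain ⟨b, hab, hbc⟩ := trans_eq_some.1 h
    obtain ⟨b', hbb', hbc⟩ := trans_eq_some.1 hbc
    obtain rfl := hfid _ _ hbb'
    exact hid _ _ (trans_eq_some.2 ⟨b, hab, hbc⟩)
  have key {a b : Fin n} (hab : φ a = some b) (hba : ρ b = some a) :
      φ.trans (f.trans ρ) a = some a ↔ f b = some b := by
    constructor
    · intro h
      obtain ⟨c, hac, hc⟩ := trans_eq_some.1 h
      obtain rfl := Option.some.inj (hab.symm.trans hac)
      obtain ⟨d, hd, -⟩ := trans_eq_some.1 hc
      obtain rfl := hfid _ _ hd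
      exact hd
    · intro h
      exact trans_eq_some.2 ⟨b, hab, trans_eq_some.2 ⟨b, h, hba⟩⟩
  rw [← key hxy hρy, ← key hv hρv]
  exact hw _ hmem hpid

/-- A nilpotent element has no arrow inside a block joining co-fixed points. -/
lemma not_coFixed_of_nilpotent (hsub : IsSubsemigroup S) {φ : ISemi n} (hφ : φ ∈ S)
    (hnil : ∃ k : ℕ, 1 ≤ k ∧ pePow φ k = ⊥) {x y : Fin n}
    (hxy : φ x = some y) (hyx : STGe S y x) : ¬ CoFixed S x y := by
  intro hco
  have hpow (k : ℕ) : ∃ v, pePow φ k x = some v ∧ CoFixed S x v := by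
    induction k with
    | zero => exact ⟨x, rfl, CoFixed.refl x⟩
    | succ k ih =>
      obtain ⟨v, hv, hxv⟩ := ih
      obtain ⟨u, hu, hyu⟩ := CoFixed.map hsub hφ hxy hyx hxv
      exact ⟨u, trans_eq_some.2 ⟨v, hv, hu⟩, hco.trans hyu⟩
  obtain ⟨k, -, hk⟩ := hnil
  obtain ⟨v, hv, -⟩ := hpow k
  rw [hk] at hv
  simp at hv

/-- Elements of `S` lying in `e_a S e_b`, where `e_a` is the least partial identity fixing `a`,
that have an arrow from the co-fixed class of `a` to that of `b`. -/
def Arrows (S : Set (ISemi n)) (a b : Fin n) : Set (ISemi n) :=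
  {α | α ∈ S ∧ (∀ f ∈ S, IsPartialId f → f a = some a → f.trans α = α) ∧
    (∀ f ∈ S, IsPartialId f → f b = some b → α.trans f = α) ∧
    ∃ a' b', CoFixed S a a' ∧ CoFixed S b b' ∧ α a' = some b'}

lemma Arrows.congr {a b a' b' : Fin n} (ha : CoFixed S a a') (hb : CoFixed S b b') {α : ISemi n}
    (h : α ∈ Arrows S a b) : α ∈ Arrows S a' b' := by
  obtain ⟨hα, hl, hr, c, d, hc, hd, hcd⟩ := h
  exact ⟨hα, fun f hf hfid h => hl f hf hfid ((ha f hf hfid).2 h),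
    fun f hf hfid h => hr f hf hfid ((hb f hf hfid).2 h),
    c, d, ha.symm.trans hc, hb.symm.trans hd, hcd⟩

lemma Arrows.coFixed {a b c d : Fin n} {α : ISemi n} (h : α ∈ Arrows S a b)
    (h' : α ∈ Arrows S c d) : CoFixed S a c ∧ CoFixed S b d := by
  obtain ⟨-, hl, hr, a', b', ha, hb, hab⟩ := h
  obtain ⟨-, hl', hr', c', d', hc, hd, hcd⟩ := h'
  have left {f : ISemi n} (hfid : IsPartialId f) (hf : f.trans α = α) {p q : Fin n}
      (hpq : α p = some q) : f p = some p := by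
    rw [← hf] at hpq
    obtain ⟨r, hr, -⟩ := trans_eq_some.1 hpq
    obtain rfl := hfid _ _ hr
    exact hr
  have right {f : ISemi n} (hfid : IsPartialId f) (hf : α.trans f = α) {p q : Fin n}
      (hpq : α p = some q) : f q = some q := by
    rw [← hf] at hpq
    obtain ⟨r, -, hr⟩ := trans_eq_some.1 hpq
    obtain rfl := hfid _ _ hr
    exact hr
  refine ⟨fun f hf hfid => ⟨fun h => ?_, fun h => ?_⟩, fun f hf hfid => ⟨fun h => ?_, fun h => ?_⟩⟩
  · exact (hc f hf hfid).2 (left hfid (hl f hf hfid h) hcd)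
  · exact (ha f hf hfid).2 (left hfid (hl' f hf hfid h) hab)
  · exact (hd f hf hfid).2 (right hfid (hr f hf hfid h) hcd)
  · exact (hb f hf hfid).2 (right hfid (hr' f hf hfid h) hab)

lemma Arrows.ne_bot {a b : Fin n} {α : ISemi n} (h : α ∈ Arrows S a b) : α ≠ ⊥ := by
  rintro rfl
  obtain ⟨-, -, -, c, d, -, -, hcd⟩ := h
  simp at hcd

lemma Arrows.exists_of_arrow (hsub : IsSubsemigroup S) (hst : Semitransitive S) {a b : Fin n}
    (hab : STGe S a b) : ∃ α ∈ Arrows S a b, α a = some b := by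
  obtain ⟨σ, hσ, hσab⟩ := hab
  obtain ⟨e, heS, he, hea, hemin⟩ := exists_least_partialId hsub hst a
  obtain ⟨e', heS', he', hea', hemin'⟩ := exists_least_partialId hsub hst b
  have hval : e.trans (σ.trans e') a = some b :=
    trans_eq_some.2 ⟨a, hea, trans_eq_some.2 ⟨b, hσab, hea'⟩⟩
  refine ⟨e.trans (σ.trans e'), ⟨hsub _ heS _ (hsub _ hσ _ heS'), fun f hf hfid h => ?_,
    fun f hf hfid h => ?_, a, b, CoFixed.refl a, CoFixed.refl b, hval⟩, hval⟩
  · rw [← PEquiv.trans_assoc, (hemin f hf hfid h).2]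
  · rw [PEquiv.trans_assoc, PEquiv.trans_assoc, (hemin' f hf hfid h).1]

lemma STGe.trans (hsub : IsSubsemigroup S) {a b c : Fin n} (h : STGe S a b) (h' : STGe S b c) :
    STGe S a c := by
  obtain ⟨α, hα, hab⟩ := h
  obtain ⟨β, hβ, hbc⟩ := h'
  exact ⟨_, hsub _ hα _ hβ, trans_eq_some.2 ⟨b, hab, hbc⟩⟩

lemma STGe.total (hst : Semitransitive S) (a b : Fin n) : STGe S a b ∨ STGe S b a := by
  obtain ⟨α, hα, h | h⟩ := hst a b
  · exact Or.inl ⟨α, hα, h⟩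
  · exact Or.inr ⟨α, hα, h⟩

lemma exists_top (hsub : IsSubsemigroup S) (hst : Semitransitive S) (s : Finset (Fin n))
    (hs : s.Nonempty) : ∃ x ∈ s, ∀ w ∈ s, STGe S x w := by
  induction hs using Finset.Nonempty.cons_induction with
  | singleton a => exact ⟨a, by simp, by simpa using STGe.total hst a a⟩
  | cons a s ha hs ih =>
    obtain ⟨x, hx, htop⟩ := ih
    rcases STGe.total hst x a with h | h
    · refine ⟨x, by simp [hx], fun w hw => ?_⟩
      rcases Finset.mem_cons.1 hw with rfl | hw
      exacts [h, htop w hw]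
    · refine ⟨a, by simp, fun w hw => ?_⟩
      rcases Finset.mem_cons.1 hw with rfl | hw
      exacts [(STGe.total hst w w).elim id id, h.trans hsub (htop w hw)]

lemma exists_top_coFixed (hsub : IsSubsemigroup S) (hst : Semitransitive S) (x : Fin n) :
    ∃ z, CoFixed S x z ∧ ∀ w, CoFixed S x w → STGe S z w := by
  classical
  obtain ⟨z, hz, htop⟩ := exists_top hsub hst (Finset.univ.filter (CoFixed S x))
    ⟨x, by simp [CoFixed.refl]⟩
  exact ⟨z, by simpa using hz, fun w hw => htop w (by simpa using hw)⟩

/-- `α` is attached to the point `w` on the `x`-side; `x` and `y` are in one block, `x₀`, `y₀` are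
top points of their co-fixed classes, and `ψ` maps `y` to `x`. -/
def Attached (S : Set (ISemi n)) (x y x₀ y₀ : Fin n) (ψ : ISemi n) (w : Fin n) (α : ISemi n) :
    Prop :=
  (CoFixed S x w ∧ α ∈ Arrows S x x ∧ α x₀ = some w) ∨
  (CoFixed S y w ∧ α ∈ Arrows S y x ∧ ∃ v, ψ w = some v ∧ α y₀ = some v) ∨
  (¬ CoFixed S x w ∧ ¬ CoFixed S y w ∧
    ((α ∈ Arrows S x w ∧ α x = some w) ∨ (α ∈ Arrows S w x ∧ α w = some x)))

lemma Attached.exists (hsub : IsSubsemigroup S) (hst : Semitransitive S) {x y x₀ y₀ : Fin n}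
    {ψ : ISemi n} (hψ : ψ ∈ S) (hyx : ψ y = some x) (hxy : STGe S x y)
    (hx₀ : CoFixed S x x₀) (hxtop : ∀ w, CoFixed S x w → STGe S x₀ w)
    (hy₀ : CoFixed S y y₀) (hytop : ∀ w, CoFixed S y w → STGe S y₀ w) (w : Fin n) :
    ∃ α, Attached S x y x₀ y₀ ψ w α := by
  by_cases hxw : CoFixed S x w
  · obtain ⟨α, hα, h⟩ := Arrows.exists_of_arrow hsub hst (hxtop w hxw)
    exact ⟨α, Or.inl ⟨hxw, Arrows.congr hx₀.symm hxw.symm hα, h⟩⟩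
  by_cases hyw : CoFixed S y w
  · obtain ⟨v, hv, hxv⟩ := CoFixed.map hsub hψ hyx hxy hyw
    obtain ⟨α, hα, h⟩ := Arrows.exists_of_arrow hsub hst
      ((hytop w hyw).trans hsub ⟨ψ, hψ, hv⟩)
    exact ⟨α, Or.inr (Or.inl ⟨hyw, Arrows.congr hy₀.symm hxv.symm hα, v, hv, h⟩)⟩
  rcases STGe.total hst x w with h | h
  · obtain ⟨α, hα, h⟩ := Arrows.exists_of_arrow hsub hst h
    exact ⟨α, Or.inr (Or.inr ⟨hxw, hyw, Or.inl ⟨hα, h⟩⟩)⟩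
  · obtain ⟨α, hα, h⟩ := Arrows.exists_of_arrow hsub hst h
    exact ⟨α, Or.inr (Or.inr ⟨hxw, hyw, Or.inr ⟨hα, h⟩⟩)⟩

lemma Attached.exists_arrows {x y x₀ y₀ w : Fin n} {ψ α : ISemi n}
    (h : Attached S x y x₀ y₀ ψ w α) : ∃ a b, α ∈ Arrows S a b := by
  rcases h with ⟨-, h, -⟩ | ⟨-, h, -⟩ | ⟨-, -, ⟨h, -⟩ | ⟨h, -⟩⟩ <;> exact ⟨_, _, h⟩

lemma Attached.unique {x y x₀ y₀ w w' : Fin n} {ψ α : ISemi n} (hne : ¬ CoFixed S x y)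
    (h : Attached S x y x₀ y₀ ψ w α) (h' : Attached S x y x₀ y₀ ψ w' α) : w = w' := by
  rcases h with ⟨hw, hα, h⟩ | ⟨hw, hα, v, hv, h⟩ | ⟨hxw, hyw, ⟨hα, h⟩ | ⟨hα, h⟩⟩ <;>
  rcases h' with ⟨hw', hα', h'⟩ | ⟨hw', hα', v', hv', h'⟩ | ⟨hxw', hyw', ⟨hα', h'⟩ | ⟨hα', h'⟩⟩ <;>
  obtain ⟨h₁, h₂⟩ := Arrows.coFixed hα hα'
  · exact Option.some.inj (h.symm.trans h')
  · exact absurd h₁ hne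
  · exact absurd h₂ hxw'
  · exact absurd h₁ hxw'
  · exact absurd h₁.symm hne
  · obtain rfl := Option.some.inj (h.symm.trans h')
    exact pequiv_inj_some hv hv'
  · exact absurd h₁.symm hne
  · exact absurd h₁ hyw'
  · exact absurd h₂.symm hxw
  · exact absurd h₁ hne
  · exact Option.some.inj (h.symm.trans h')
  · exact absurd h₁ hxw'
  · exact absurd h₁.symm hxw
  · exact absurd h₁.symm hyw
  · exact absurd h₁.symm hxw
  · exact pequiv_inj_some h h'

lemma Attached.not_swap {x y x₀ y₀ w w' : Fin n} {φ ψ α : ISemi n} (hne : ¬ CoFixed S x y)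
    (h : Attached S x y x₀ y₀ ψ w α) (h' : Attached S y x y₀ x₀ φ w' α) : False := by
  have hne' : ¬ CoFixed S y x := fun h => hne h.symm
  rcases h with ⟨hw, hα, -⟩ | ⟨hw, hα, -⟩ | ⟨hxw, hyw, ⟨hα, -⟩ | ⟨hα, -⟩⟩ <;>
  rcases h' with ⟨hw', hα', -⟩ | ⟨hw', hα', -⟩ | ⟨hyw', hxw', ⟨hα', -⟩ | ⟨hα', -⟩⟩ <;>
  obtain ⟨h₁, h₂⟩ := Arrows.coFixed hα hα'
  all_goals first
    | exact hne h₁ | exact hne h₂ | exact hne' h₁ | exact hne' h₂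
    | exact hxw h₁.symm | exact hxw h₂.symm | exact hyw h₁.symm | exact hyw h₂.symm
    | exact hxw' h₁ | exact hxw' h₂

/-- If `S` contains zero and some transitivity block is not a single co-fixed class, then
`S` has more than `2 * n` elements. -/
lemma two_mul_lt_ncard (hsub : IsSubsemigroup S) (hst : Semitransitive S) (hbot : ⊥ ∈ S)
    {x y : Fin n} (hxy : STGe S x y) (hyx : STGe S y x) (hne : ¬ CoFixed S x y) :
    2 * n < S.ncard := by
  obtain ⟨φ, hφ, hφxy⟩ := id hxy
  obtain ⟨ψ, hψ, hψyx⟩ := id hyx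
  obtain ⟨x₀, hx₀, hxtop⟩ := exists_top_coFixed hsub hst x
  obtain ⟨y₀, hy₀, hytop⟩ := exists_top_coFixed hsub hst y
  choose P hP using Attached.exists hsub hst hψ hψyx hxy hx₀ hxtop hy₀ hytop
  choose Q hQ using Attached.exists hsub hst hφ hφxy hyx hy₀ hytop hx₀ hxtop
  have hPA (w : Fin n) := (hP w).exists_arrows
  have hQA (w : Fin n) := (hQ w).exists_arrows
  have hPinj : Function.Injective P := fun w w' h => (hP w).unique hne (h ▸ hP w')
  have hQinj : Function.Injective Q := fun w w' h =>
    (hQ w).unique (fun h => hne h.symm) (h ▸ hQ w')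
  have hPQ (w w' : Fin n) : P w ≠ Q w' := fun h => (hP w).not_swap hne (h ▸ hQ w')
  have hinj : Function.Injective (Sum.elim P Q) := hPinj.sumElim hQinj hPQ
  have hmem : Set.range (Sum.elim P Q) ⊆ S \ {⊥} := by
    rintro _ ⟨w | w, rfl⟩
    · obtain ⟨a, b, h⟩ := hPA w
      exact ⟨h.1, Arrows.ne_bot h⟩
    · obtain ⟨a, b, h⟩ := hQA w
      exact ⟨h.1, Arrows.ne_bot h⟩
  have hcard : (Set.range (Sum.elim P Q)).ncard = 2 * n := by
    rw [← Set.image_univ, Set.ncard_image_of_injective _ hinj, Set.ncard_univ]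
    simp [two_mul]
  have hle := Set.ncard_le_ncard hmem (Set.toFinite _)
  have hlt := Set.ncard_sdiff_singleton_lt_of_mem hbot S.toFinite
  omega

end CoFixed

/-- with `g, h` two distinct non-zero idempotents of a semitransitive
subsemigroup `S` of the singular part with `|S| ≤ 2n`, any nilpotent element of
`S' = gSg ∪ gSh ∪ hSg ∪ hSh` has no arrow from a transitivity block to itself:
if `φ x = y` then no `ψ ∈ S` maps `y` back to `x`. -/
theorem stmt7 (n : ℕ) (hn : 1 ≤ n) (S : Set (ISemi n))
    (hsub : IsSubsemigroup S)
    (hsing : ∀ φ ∈ S, IsSingular φ)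
    (hst : Semitransitive S)
    (hcard : S.ncard ≤ 2 * n)
    (g h : ISemi n) (hg : g ∈ S) (hh : h ∈ S) (hgh : g ≠ h)
    (hgid : g.trans g = g) (hhid : h.trans h = h) (hg0 : g ≠ ⊥) (hh0 : h ≠ ⊥)
    (φ : ISemi n)
    (hφ : ∃ σ ∈ S, φ = g.trans (σ.trans g) ∨ φ = g.trans (σ.trans h) ∨
      φ = h.trans (σ.trans g) ∨ φ = h.trans (σ.trans h))
    (hnil : ∃ k : ℕ, 1 ≤ k ∧ pePow φ k = ⊥)
    (x y : Fin n) (hxy : φ x = some y) :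
    ¬ STGe S y x := by
  intro hyx
  have hφS : φ ∈ S := by
    obtain ⟨σ, hσ, rfl | rfl | rfl | rfl⟩ := hφ
    exacts [hsub _ hg _ (hsub _ hσ _ hg), hsub _ hg _ (hsub _ hσ _ hh),
      hsub _ hh _ (hsub _ hσ _ hg), hsub _ hh _ (hsub _ hσ _ hh)]
  have hbot : ⊥ ∈ S := by
    obtain ⟨k, hk, hpow⟩ := hnil
    obtain ⟨m, rfl⟩ := Nat.exists_eq_add_of_le' hk
    exact hpow ▸ pePow_mem hsub hφS m
  have := two_mul_lt_ncard hsub hst hbot ⟨φ, hφS, hxy⟩ hyx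
    (not_coFixed_of_nilpotent hsub hφS hnil hxy hyx)
  omega
end

section
/- Let S be a semitransitive subsemigroup of the singular part I_n \ S_n with |S| ≤ 2n, and let t denote the minimal cardinality of a transitivity block of S. Then the cardinality of every transitivity block of S is divisible by t. -/
namespace PartialPerm

variable {n : ℕ} {S : Set (ISemi n)}

/-- `φ` is the identity on its domain. -/
def IsPartialId (φ : ISemi n) : Prop := ∀ u v, φ u = some v → u = v

/-- The graph of `φ` is contained in `U × V`. -/
def Within (U V : Set (Fin n)) (φ : ISemi n) : Prop := ∀ w z, φ w = some z → w ∈ U ∧ z ∈ V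

/-- The points fixed by every idempotent of `S` that fixes `x`, i.e. the domain of the least
idempotent of `S` defined at `x`. -/
def core (S : Set (ISemi n)) (x : Fin n) : Set (Fin n) :=
  {w | ∀ f ∈ S, IsPartialId f → f x = some x → f w = some w}

/-- `x` and `y` lie in the same transitivity block. -/
def SameBlock (S : Set (ISemi n)) (x y : Fin n) : Prop := STGe S x y ∧ STGe S y x

instance : Finite (ISemi n) := Finite.of_injective _ DFunLike.coe_injective

lemma ext_graph {φ ψ : ISemi n} (h : ∀ x y, φ x = some y ↔ ψ x = some y) : φ = ψ := by
  ext x : 1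
  exact Option.ext fun y => h x y

lemma eq_of_map_eq {φ : ISemi n} {x x' y : Fin n} (h : φ x = some y) (h' : φ x' = some y) :
    x = x' := φ.inj h h'

lemma eq_of_apply {φ : ISemi n} {x y y' : Fin n} (h : φ x = some y) (h' : φ x = some y') :
    y = y' := Option.some.inj (h.symm.trans h')

lemma trans_apply {φ ψ : ISemi n} {x y z : Fin n} (h : φ x = some y) (h' : ψ y = some z) :
    (φ.trans ψ) x = some z := (PEquiv.trans_eq_some _ _ _ _).2 ⟨y, h, h'⟩

lemma of_trans_apply {φ ψ : ISemi n} {x z : Fin n} (h : (φ.trans ψ) x = some z) :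
    ∃ y, φ x = some y ∧ ψ y = some z := (PEquiv.trans_eq_some _ _ _ _).1 h

lemma pePow_add (φ : ISemi n) (i j : ℕ) :
    pePow φ (i + j) = (pePow φ i).trans (pePow φ j) := by
  induction j with
  | zero => simp [pePow]
  | succ j ih => rw [← Nat.add_assoc]; simp only [pePow, ih, PEquiv.trans_assoc]

lemma pePow_one (φ : ISemi n) : pePow φ 1 = φ := by simp [pePow]

lemma pePow_mem (hsub : IsSubsemigroup S) {φ : ISemi n} (h : φ ∈ S) (k : ℕ) :
    pePow φ (k + 1) ∈ S := by
  induction k with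
  | zero => simpa [pePow_one] using h
  | succ k ih => exact hsub _ ih _ h

lemma pePow_fix {φ : ISemi n} {x : Fin n} (h : φ x = some x) (k : ℕ) :
    pePow φ k x = some x := by
  induction k with
  | zero => simp [pePow]
  | succ k ih => exact trans_apply ih h

lemma pePow_maps {φ : ISemi n} {U : Set (Fin n)} (h : ∀ w ∈ U, ∃ v ∈ U, φ w = some v) (k : ℕ) :
    ∀ w ∈ U, ∃ v ∈ U, pePow φ k w = some v := by
  induction k with
  | zero => exact fun w hw => ⟨w, hw, by simp [pePow]⟩
  | succ k ih =>
    intro w hw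
    obtain ⟨v, hv, h1⟩ := ih w hw
    obtain ⟨u, hu, h2⟩ := h v hv
    exact ⟨u, hu, trans_apply h1 h2⟩

/-- Some power of an element of `S` is idempotent. -/
lemma exists_partialId (hsub : IsSubsemigroup S) {θ : ISemi n} (hθ : θ ∈ S) :
    ∃ ρ ∈ S, IsPartialId (θ.trans ρ) ∧ ρ.trans θ = θ.trans ρ ∧
      (∀ x, θ x = some x → ρ x = some x) ∧
      ∀ U : Set (Fin n), (∀ w ∈ U, ∃ v ∈ U, θ w = some v) → ∀ w ∈ U, ∃ v ∈ U, ρ w = some v := by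
  obtain ⟨i, d, hd, hid⟩ : ∃ i d, 0 < d ∧ pePow θ i = pePow θ (i + d) := by
    obtain ⟨i, j, hne, h⟩ := Finite.exists_ne_map_eq_of_infinite (pePow θ)
    rcases lt_or_gt_of_ne hne with h1 | h1
    · exact ⟨i, j - i, by omega, by rw [h]; congr 1; omega⟩
    · exact ⟨j, i - j, by omega, by rw [← h]; congr 1; omega⟩
  have step : ∀ k c, pePow θ (i + k) = pePow θ (i + k + c * d) := by
    intro k c
    induction c with
    | zero => simp
    | succ c ih =>
      have e : i + k + (c + 1) * d = i + d + (k + c * d) := by ring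
      rw [ih, e, pePow_add θ (i + d), ← hid, ← pePow_add]
      congr 1; ring
  obtain ⟨m, hm, hidem⟩ : ∃ m, 0 < m ∧ pePow θ m = pePow θ (m + m) := by
    refine ⟨(i + 1) * d, by positivity, ?_⟩
    have hle : i ≤ (i + 1) * d := by nlinarith
    have := step ((i + 1) * d - i) (i + 1)
    rwa [Nat.add_sub_cancel' hle] at this
  obtain ⟨k, rfl⟩ : ∃ k, m = k + 1 := ⟨m - 1, by omega⟩
  have e1 : θ.trans (pePow θ (2 * k + 1)) = pePow θ (k + 1) := by
    rw [hidem]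
    conv_lhs => rw [← pePow_one θ, ]
    rw [pePow_one θ]
    have := pePow_add θ 1 (2 * k + 1)
    rw [pePow_one] at this
    rw [← this]; congr 1; ring
  refine ⟨pePow θ (2 * k + 1), pePow_mem hsub hθ _, ?_, ?_, fun x hx => pePow_fix hx _,
    fun U hU => pePow_maps hU _⟩
  · rw [e1]
    intro u v h
    have h2 := h
    rw [hidem, pePow_add] at h2
    obtain ⟨w, hw, hw'⟩ := of_trans_apply h2
    obtain rfl := eq_of_apply hw h
    exact eq_of_map_eq h hw'
  · rw [e1, hidem]
    change pePow θ (2 * k + 1 + 1) = _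
    congr 1; ring

lemma stge_trans (hsub : IsSubsemigroup S) {x y z : Fin n} (h : STGe S x y) (h' : STGe S y z) :
    STGe S x z := by
  obtain ⟨φ, hφ, e⟩ := h
  obtain ⟨ψ, hψ, e'⟩ := h'
  exact ⟨_, hsub _ hφ _ hψ, trans_apply e e'⟩

lemma stge_total (hst : Semitransitive S) (x y : Fin n) : STGe S x y ∨ STGe S y x := by
  obtain ⟨φ, hφ, h | h⟩ := hst x y
  · exact Or.inl ⟨φ, hφ, h⟩
  · exact Or.inr ⟨φ, hφ, h⟩

lemma stge_refl (hst : Semitransitive S) (x : Fin n) : STGe S x x :=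
  (stge_total hst x x).elim id id

lemma SameBlock.symm {x y : Fin n} (h : SameBlock S x y) : SameBlock S y x := ⟨h.2, h.1⟩

lemma sameBlock_trans (hsub : IsSubsemigroup S) {x y z : Fin n} (h : SameBlock S x y)
    (h' : SameBlock S y z) : SameBlock S x z :=
  ⟨stge_trans hsub h.1 h'.1, stge_trans hsub h'.2 h.2⟩

lemma mem_core_self (x : Fin n) : x ∈ core S x := fun _ _ _ h => h

lemma core_subset {x y : Fin n} (h : y ∈ core S x) : core S y ⊆ core S x :=
  fun _ hw f hf hid hx => hw f hf hid (h f hf hid hx)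

lemma core_eq {x y : Fin n} (h : y ∈ core S x) (h' : x ∈ core S y) : core S x = core S y :=
  (core_subset h').antisymm (core_subset h)

/-- The identity map of `core S x` belongs to `S`. -/
lemma exists_core_id (hsub : IsSubsemigroup S) (hst : Semitransitive S) (x : Fin n) :
    ∃ e ∈ S, ∀ u v, e u = some v ↔ u = v ∧ u ∈ core S x := by
  classical
  obtain ⟨θ, hθ, hx⟩ := stge_refl hst x
  obtain ⟨ρ, hρ, hid, -, hfix, -⟩ := exists_partialId hsub hθ
  obtain ⟨f, ⟨hf, hfid, hfx⟩, hmin⟩ := Set.exists_min_image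
    {f : ISemi n | f ∈ S ∧ IsPartialId f ∧ f x = some x}
    (fun f => (Finset.univ.filter fun u => f u = some u).card) (Set.toFinite _)
    ⟨θ.trans ρ, hsub _ hθ _ hρ, hid, trans_apply hx (hfix x hx)⟩
  refine ⟨f, hf, fun u v => ⟨fun h => ?_, fun ⟨h1, h2⟩ => h1 ▸ h2 f hf hfid hfx⟩⟩
  obtain rfl := hfid u v h
  refine ⟨rfl, fun g hg hgid hgx => ?_⟩
  have hle := hmin (f.trans g) ⟨hsub _ hf _ hg, fun a b hab => by
    obtain ⟨c, h1, h2⟩ := of_trans_apply hab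
    exact (hfid _ _ h1).trans (hgid _ _ h2), trans_apply hfx hgx⟩
  have hss : (Finset.univ.filter fun u => (f.trans g) u = some u) ⊆
      Finset.univ.filter fun u => f u = some u := by
    intro a ha
    simp only [Finset.mem_filter, Finset.mem_univ, true_and] at ha ⊢
    obtain ⟨c, h1, h2⟩ := of_trans_apply ha
    obtain rfl := hfid _ _ h1
    exact h1
  have heq := Finset.eq_of_subset_of_card_le hss hle
  have hu : u ∈ Finset.univ.filter fun u => f u = some u := by simpa using h
  rw [← heq] at hu
  simp only [Finset.mem_filter, Finset.mem_univ, true_and] at hu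
  obtain ⟨c, h1, h2⟩ := of_trans_apply hu
  obtain rfl := hfid _ _ h1
  exact h2

/-- A map between points of one block is defined on the whole core of its argument. -/
lemma total_on_core (hsub : IsSubsemigroup S) {φ : ISemi n} (hφ : φ ∈ S) {x y w : Fin n}
    (hxy : φ x = some y) (hyx : STGe S y x) (hw : w ∈ core S x) :
    ∃ v, φ w = some v ∧ SameBlock S w v := by
  obtain ⟨ψ, hψ, hψy⟩ := hyx
  obtain ⟨ρ, hρ, hid, -, hfix, -⟩ := exists_partialId hsub (hsub _ hφ _ hψ)
  have hx := trans_apply hxy hψy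
  have := hw _ (hsub _ (hsub _ hφ _ hψ) _ hρ) hid (trans_apply hx (hfix _ hx))
  rw [PEquiv.trans_assoc] at this
  obtain ⟨v, h1, h2⟩ := of_trans_apply this
  exact ⟨v, h1, ⟨φ, hφ, h1⟩, ⟨_, hsub _ hψ _ hρ, h2⟩⟩

lemma exists_within (hsub : IsSubsemigroup S) (hst : Semitransitive S) {x y : Fin n}
    (h : STGe S x y) : ∃ φ ∈ S, Within (core S x) (core S y) φ ∧ φ x = some y := by
  obtain ⟨φ, hφ, hxy⟩ := h
  obtain ⟨e, he, hex⟩ := exists_core_id hsub hst x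
  obtain ⟨f, hf, hfy⟩ := exists_core_id hsub hst y
  refine ⟨(e.trans φ).trans f, hsub _ (hsub _ he _ hφ) _ hf, ?_, ?_⟩
  · intro w z hwz
    obtain ⟨b, h1, h2⟩ := of_trans_apply hwz
    obtain ⟨a, h3, h4⟩ := of_trans_apply h1
    obtain ⟨rfl, h5⟩ := (hfy _ _).1 h2
    exact ⟨((hex _ _).1 h3).2, h5⟩
  · exact trans_apply (trans_apply ((hex _ _).2 ⟨rfl, mem_core_self x⟩) hxy)
      ((hfy _ _).2 ⟨rfl, mem_core_self y⟩)

/-- The empty map belongs to `S`. -/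
lemma bot_mem (hn : 1 ≤ n) (hsub : IsSubsemigroup S) (hsing : ∀ φ ∈ S, IsSingular φ)
    (hst : Semitransitive S) : (⊥ : ISemi n) ∈ S := by
  classical
  by_contra hbot
  obtain ⟨φ₀, hφ₀, -⟩ := hst ⟨0, hn⟩ ⟨0, hn⟩
  let dom : ISemi n → Finset (Fin n) := fun f => Finset.univ.filter fun u => ∃ v, f u = some v
  obtain ⟨θ, hθ, hmin⟩ := Set.exists_min_image S (fun f => (dom f).card) (Set.toFinite _) ⟨_, hφ₀⟩
  obtain ⟨ρ, hρ, hid, -⟩ := exists_partialId hsub hθ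
  set f := θ.trans ρ with hf
  have hfS : f ∈ S := hsub _ hθ _ hρ
  have hfθ : dom f ⊆ dom θ := by
    intro u hu
    simp only [dom, Finset.mem_filter, Finset.mem_univ, true_and] at hu ⊢
    obtain ⟨v, hv⟩ := hu
    obtain ⟨w, h1, -⟩ := of_trans_apply hv
    exact ⟨w, h1⟩
  have hinv : ∀ s ∈ S, ∀ u, f u = some u → ∃ v, s u = some v ∧ f v = some v := by
    intro s hs u hu
    have hss : dom ((f.trans s).trans f) ⊆ dom f := by
      intro a ha
      simp only [dom, Finset.mem_filter, Finset.mem_univ, true_and] at ha ⊢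
      obtain ⟨v, hv⟩ := ha
      obtain ⟨w, h1, -⟩ := of_trans_apply hv
      obtain ⟨w', h2, -⟩ := of_trans_apply h1
      exact ⟨w', h2⟩
    have heq := Finset.eq_of_subset_of_card_le hss
      ((Finset.card_le_card hfθ).trans (hmin _ (hsub _ (hsub _ hfS _ hs) _ hfS)))
    have hud : u ∈ dom f := by simpa [dom] using ⟨u, hu⟩
    rw [← heq] at hud
    simp only [dom, Finset.mem_filter, Finset.mem_univ, true_and] at hud
    obtain ⟨v, hv⟩ := hud
    obtain ⟨w, h1, h2⟩ := of_trans_apply hv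
    obtain ⟨w', h3, h4⟩ := of_trans_apply h1
    obtain rfl := hid _ _ h2
    obtain rfl := hid _ _ h3
    exact ⟨w, h4, h2⟩
  obtain ⟨u, hu⟩ : ∃ u, f u = some u := by
    by_contra hno
    push Not at hno
    apply hbot
    convert hfS
    refine ext_graph fun x y => ⟨fun h => by simp at h, fun h => ?_⟩
    obtain rfl := hid _ _ h
    exact absurd h (hno _)
  obtain ⟨y, hy⟩ := hsing f hfS
  obtain ⟨φ, hφ, h | h⟩ := hst u y
  · obtain ⟨v, h1, h2⟩ := hinv φ hφ u hu
    obtain rfl := eq_of_apply h h1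
    simp [hy] at h2
  · obtain ⟨ρ', hρ', hid', hcomm, -⟩ := exists_partialId hsub hφ
    obtain ⟨v, h1, -⟩ := hinv _ (hsub _ hφ _ hρ') u hu
    obtain rfl := hid' _ _ h1
    rw [← hcomm] at h1
    obtain ⟨w, h3, h4⟩ := of_trans_apply h1
    obtain ⟨w', h5, h6⟩ := hinv _ hρ' u hu
    obtain rfl := eq_of_apply h3 h5
    obtain rfl := eq_of_map_eq h h4
    simp [hy] at h6

/-- A family of partial matchings that covers each pair of `O × P` exactly once, and whose images
in `P` are equal as soon as they meet, has cardinality divisible by that of `O`. -/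
lemma card_dvd_of_unique_cover {ι α β : Type*} (N : Finset ι) (O : Finset α) (P : Finset β)
    (r : ι → α → β → Prop) (hN : ∀ i ∈ N, ∃ x ∈ O, ∃ y ∈ P, r i x y)
    (hcov : ∀ x ∈ O, ∀ y ∈ P, ∃ i ∈ N, r i x y)
    (huniq : ∀ x ∈ O, ∀ y ∈ P, ∀ i ∈ N, ∀ j ∈ N, r i x y → r j x y → i = j)
    (hinj : ∀ i x x' y, r i x y → r i x' y → x = x')
    (himage : ∀ i ∈ N, ∀ j ∈ N, ∀ x ∈ O, ∀ x' ∈ O, ∀ y ∈ P, r i x y → r j x' y →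
      ∀ y' ∈ P, ∀ u ∈ O, r i u y' → ∃ u' ∈ O, r j u' y') : O.card ∣ N.card := by
  classical
  let im : ι → Finset β := fun i => P.filter fun y => ∃ u ∈ O, r i u y
  rw [Finset.card_eq_sum_card_image im N]
  refine Finset.dvd_sum fun I hI => ?_
  obtain ⟨i₀, hi₀, rfl⟩ := Finset.mem_image.1 hI
  obtain ⟨x₀, hx₀, y, hy, hr₀⟩ := hN i₀ hi₀
  have key : ∀ i ∈ N.filter (fun i => im i = im i₀), ∃ u ∈ O, r i u y := by
    intro i hi
    have hmem : y ∈ im i := by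
      rw [(Finset.mem_filter.1 hi).2]
      exact Finset.mem_filter.2 ⟨hy, x₀, hx₀, hr₀⟩
    exact (Finset.mem_filter.1 hmem).2
  choose g hgO hgr using key
  refine (Finset.card_bij g hgO ?_ ?_).symm.dvd
  · intro i hi j hj hij
    refine huniq _ (hgO i hi) y hy i (Finset.mem_filter.1 hi).1 j (Finset.mem_filter.1 hj).1
      (hgr i hi) ?_
    rw [hij]
    exact hgr j hj
  · intro x hx
    obtain ⟨i, hi, hr⟩ := hcov x hx y hy
    have him : im i = im i₀ := by
      ext y'
      simp only [im, Finset.mem_filter]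
      refine and_congr_right fun hy' => ⟨?_, ?_⟩
      · rintro ⟨u, hu, hru⟩
        exact himage i hi i₀ hi₀ x hx x₀ hx₀ y hy hr hr₀ y' hy' u hu hru
      · rintro ⟨u, hu, hru⟩
        exact himage i₀ hi₀ i hi x₀ hx₀ x hx y hy hr₀ hr y' hy' u hu hru
    have hif : i ∈ N.filter (fun i => im i = im i₀) := Finset.mem_filter.2 ⟨hi, him⟩
    exact ⟨i, hif, hinj i _ _ y (hgr i hif) hr⟩

/-- The numerical conclusion for a nonempty set of `N` maps that meet `O × P` and are permuted
transitively on both sides, where `O`, `P` have cardinalities `o`, `p`. -/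
def CellBound (o p N : ℕ) : Prop := o ≤ N ∧ p ≤ N ∧ (N < 2 * max o p → o ∣ p ∨ p ∣ o)

lemma cellBound_card (N : Finset (ISemi n)) (O P : Finset (Fin n))
    (hne : N.Nonempty)
    (hN : ∀ φ ∈ N, ∃ x ∈ O, ∃ y ∈ P, φ x = some y)
    (hL : ∀ x ∈ O, ∀ x' ∈ O, ∃ g : ISemi n, g x = some x' ∧
      (∀ w ∈ O, ∃ w' ∈ O, g w = some w') ∧
      ∀ φ ∈ N, g.trans φ ∈ N ∧ g.symm.trans (g.trans φ) = φ)
    (hR : ∀ y ∈ P, ∀ y' ∈ P, ∃ k : ISemi n, k y = some y' ∧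
      (∀ w ∈ P, ∃ w' ∈ P, k w' = some w) ∧
      ∀ φ ∈ N, φ.trans k ∈ N ∧ (φ.trans k).trans k.symm = φ) :
    CellBound O.card P.card N.card := by
  classical
  have hcov : ∀ x ∈ O, ∀ y ∈ P, ∃ φ ∈ N, φ x = some y := by
    intro x hx y hy
    obtain ⟨φ, hφ⟩ := hne
    obtain ⟨x', hx', y', hy', h⟩ := hN φ hφ
    obtain ⟨g, hg, -, hgN⟩ := hL x hx x' hx'
    obtain ⟨k, hk, -, hkN⟩ := hR y' hy' y hy
    exact ⟨_, (hkN _ (hgN _ hφ).1).1, trans_apply (trans_apply hg h) hk⟩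
  obtain ⟨φ₀, hφ₀⟩ := hne
  obtain ⟨x₀, hx₀, y₀, hy₀, -⟩ := hN φ₀ hφ₀
  have hO : O.card ≤ N.card := by
    have := fun x (hx : x ∈ O) => hcov x hx y₀ hy₀
    choose g hgN hg using this
    refine Finset.card_le_card_of_forall_subsingleton (fun x φ => φ x = some y₀)
      (fun x hx => ⟨g x hx, hgN x hx, hg x hx⟩) ?_
    rintro φ - x ⟨-, hx⟩ x' ⟨-, hx'⟩
    exact eq_of_map_eq hx hx'
  have hP : P.card ≤ N.card := by
    have := fun y (hy : y ∈ P) => hcov x₀ hx₀ y hy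
    choose g hgN hg using this
    refine Finset.card_le_card_of_forall_subsingleton (fun y φ => φ x₀ = some y)
      (fun y hy => ⟨g y hy, hgN y hy, hg y hy⟩) ?_
    rintro φ - y ⟨-, hy⟩ y' ⟨-, hy'⟩
    exact eq_of_apply hy hy'
  refine ⟨hO, hP, fun hlt => ?_⟩
  have hmult : ∀ x ∈ O, ∀ y ∈ P, ∀ x' ∈ O, ∀ y' ∈ P,
      (N.filter fun φ => φ x = some y).card ≤ (N.filter fun φ => φ x' = some y').card := by
    intro x hx y hy x' hx' y' hy'
    obtain ⟨g, hg, -, hgN⟩ := hL x' hx' x hx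
    obtain ⟨k, hk, -, hkN⟩ := hR y hy y' hy'
    refine Finset.card_le_card_of_injOn (fun φ => (g.trans φ).trans k) ?_ ?_
    · intro φ hφ
      simp only [Finset.coe_filter, Set.mem_ofPred_eq] at hφ ⊢
      exact ⟨(hkN _ (hgN _ hφ.1).1).1, trans_apply (trans_apply hg hφ.2) hk⟩
    · intro φ hφ ψ hψ h
      simp only [Finset.coe_filter, Set.mem_ofPred_eq] at hφ hψ h
      rw [← (hgN _ hφ.1).2, ← (hkN _ (hgN _ hφ.1).1).2, h, (hkN _ (hgN _ hψ.1).1).2,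
        (hgN _ hψ.1).2]
  have hone : ∃ x ∈ O, ∃ y ∈ P, (N.filter fun φ => φ x = some y).card ≤ 1 := by
    by_contra hno
    push Not at hno
    have hsumO : ∀ y ∈ P, 2 * O.card ≤ N.card := by
      intro y hy
      have h1 : ∑ x ∈ O, (N.filter fun φ => φ x = some y).card ≤ N.card := by
        rw [← Finset.card_biUnion]
        · exact Finset.card_le_card (Finset.biUnion_subset.2 fun x _ => Finset.filter_subset _ _)
        · intro x _ x' _ hxx
          refine Finset.disjoint_left.2 fun φ h h' => hxx ?_
          exact eq_of_map_eq (Finset.mem_filter.1 h).2 (Finset.mem_filter.1 h').2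
      have h2 : ∑ _x ∈ O, 2 ≤ ∑ x ∈ O, (N.filter fun φ => φ x = some y).card :=
        Finset.sum_le_sum fun x hx => hno x hx y hy
      rw [Finset.sum_const, smul_eq_mul] at h2
      omega
    have hsumP : ∀ x ∈ O, 2 * P.card ≤ N.card := by
      intro x hx
      have h1 : ∑ y ∈ P, (N.filter fun φ => φ x = some y).card ≤ N.card := by
        rw [← Finset.card_biUnion]
        · exact Finset.card_le_card (Finset.biUnion_subset.2 fun x _ => Finset.filter_subset _ _)
        · intro y _ y' _ hyy
          refine Finset.disjoint_left.2 fun φ h h' => hyy ?_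
          exact eq_of_apply (Finset.mem_filter.1 h).2 (Finset.mem_filter.1 h').2
      have h2 : ∑ _y ∈ P, 2 ≤ ∑ y ∈ P, (N.filter fun φ => φ x = some y).card :=
        Finset.sum_le_sum fun y hy => hno x hx y hy
      rw [Finset.sum_const, smul_eq_mul] at h2
      omega
    have := hsumO y₀ hy₀
    have := hsumP x₀ hx₀
    omega
  obtain ⟨x₁, hx₁, y₁, hy₁, hone⟩ := hone
  have huniq : ∀ x ∈ O, ∀ y ∈ P, ∀ φ ∈ N, ∀ ψ ∈ N, φ x = some y → ψ x = some y → φ = ψ := by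
    intro x hx y hy φ hφ ψ hψ h h'
    exact Finset.card_le_one.1 ((hmult x hx y hy x₁ hx₁ y₁ hy₁).trans hone) φ
      (Finset.mem_filter.2 ⟨hφ, h⟩) ψ (Finset.mem_filter.2 ⟨hψ, h'⟩)
  have dO : O.card ∣ N.card := by
    refine card_dvd_of_unique_cover N O P (fun φ x y => φ x = some y) hN hcov huniq
      (fun φ x x' y h h' => eq_of_map_eq h h') ?_
    intro φ hφ ψ hψ x hx x' hx' y hy h h' y' hy' u hu hu'
    obtain ⟨g, hg, hgO, hgN⟩ := hL x hx x' hx'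
    have e : g.trans ψ = φ := huniq x hx y hy _ (hgN ψ hψ).1 φ hφ (trans_apply hg h') h
    rw [← e] at hu'
    obtain ⟨v, h1, h2⟩ := of_trans_apply hu'
    obtain ⟨w, hw, hw'⟩ := hgO u hu
    obtain rfl := eq_of_apply h1 hw'
    exact ⟨v, hw, h2⟩
  have dP : P.card ∣ N.card := by
    refine card_dvd_of_unique_cover N P O (fun φ y x => φ x = some y) ?_
      (fun y hy x hx => hcov x hx y hy) (fun y hy x hx => huniq x hx y hy)
      (fun φ y y' x h h' => eq_of_apply h h') ?_
    · intro φ hφ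
      obtain ⟨x, hx, y, hy, h⟩ := hN φ hφ
      exact ⟨y, hy, x, hx, h⟩
    · intro φ hφ ψ hψ y hy y' hy' x hx h h' x' hx' u hu hu'
      obtain ⟨k, hk, hkP, hkN⟩ := hR y' hy' y hy
      have e : ψ.trans k = φ := huniq x hx y hy _ (hkN ψ hψ).1 φ hφ (trans_apply h' hk) h
      rw [← e] at hu'
      obtain ⟨v, h1, h2⟩ := of_trans_apply hu'
      obtain ⟨w, hw, hw'⟩ := hkP u hu
      obtain rfl := eq_of_map_eq h2 hw'
      exact ⟨v, hw, h1⟩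
  have hpos : 0 < N.card := Finset.card_pos.2 ⟨φ₀, hφ₀⟩
  rcases le_total O.card P.card with hle | hle
  · rw [max_eq_right hle] at hlt
    obtain ⟨c, hc⟩ := dP
    have : c = 1 := by
      have : c < 2 := by nlinarith
      rcases c with _ | _ | c <;> omega
    subst this
    rw [mul_one] at hc
    exact Or.inl (hc ▸ dO)
  · rw [max_eq_left hle] at hlt
    obtain ⟨c, hc⟩ := dO
    have : c = 1 := by
      have : c < 2 := by nlinarith
      rcases c with _ | _ | c <;> omega
    subst this
    rw [mul_one] at hc
    exact Or.inr (hc ▸ dP)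

/-- All points of `U` have core `U`, and `U` is a union of transitivity blocks. -/
def IsClass (S : Set (ISemi n)) (U : Set (Fin n)) : Prop :=
  ∀ x ∈ U, core S x = U ∧ ∀ y, SameBlock S x y → y ∈ U

/-- The elements of `S` within `U × V` that map a point of the block of `a` to a point of the
block of `b`, and whose graph is contained in the relation `R`. -/
def cell (S : Set (ISemi n)) (U V : Set (Fin n)) (a b : Fin n) (R : Fin n → Fin n → Prop) :
    Set (ISemi n) :=
  {φ | φ ∈ S ∧ Within U V φ ∧ (∃ x y, SameBlock S a x ∧ SameBlock S b y ∧ φ x = some y) ∧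
    ∀ w z, φ w = some z → R w z}

lemma class_perm (hsub : IsSubsemigroup S) {U : Set (Fin n)} (hU : IsClass S U) {g : ISemi n}
    (hg : g ∈ S) {x x' : Fin n} (hx : x ∈ U) (hxx : SameBlock S x x') (hgx : g x = some x') :
    (∀ w ∈ U, ∃ v ∈ U, g w = some v ∧ SameBlock S w v) ∧
      ∀ w ∈ U, ∃ v ∈ U, g v = some w ∧ SameBlock S v w := by
  have h1 : ∀ w ∈ U, ∃ v ∈ U, g w = some v ∧ SameBlock S w v := by
    intro w hw
    obtain ⟨v, hv, hb⟩ := total_on_core hsub hg hgx hxx.2 ((hU x hx).1.symm ▸ hw)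
    exact ⟨v, (hU w hw).2 v hb, hv, hb⟩
  refine ⟨h1, fun w hw => ?_⟩
  obtain ⟨ρ, hρ, hid, hcomm, -, hmaps⟩ := exists_partialId hsub hg
  have h2 := hmaps U fun w hw => let ⟨v, hv, h, _⟩ := h1 w hw; ⟨v, hv, h⟩
  obtain ⟨v, hv, hρv⟩ := h2 w hw
  obtain ⟨u, -, hgu, hb⟩ := h1 v hv
  have := trans_apply hρv hgu
  rw [hcomm] at this
  obtain rfl := hid _ _ this
  exact ⟨v, hv, hgu, hb⟩

lemma cellBound_cell (hsub : IsSubsemigroup S) (hst : Semitransitive S) {U V : Set (Fin n)}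
    (hU : IsClass S U) (hV : IsClass S V) {a b : Fin n} (ha : a ∈ U) (hb : b ∈ V)
    {R : Fin n → Fin n → Prop}
    (hR : ∀ w w' z z', SameBlock S w w' → SameBlock S z z' → R w z → R w' z')
    (hne : (cell S U V a b R).Nonempty) :
    CellBound (STBlock S a).ncard (STBlock S b).ncard (cell S U V a b R).ncard := by
  classical
  have hrefl : ∀ z, SameBlock S z z := fun z => ⟨stge_refl hst z, stge_refl hst z⟩
  rw [Set.ncard_eq_toFinset_card _ (Set.toFinite (STBlock S a)),
    Set.ncard_eq_toFinset_card _ (Set.toFinite (STBlock S b)),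
    Set.ncard_eq_toFinset_card _ (Set.toFinite (cell S U V a b R))]
  have memB : ∀ c x, x ∈ (Set.toFinite (STBlock S c)).toFinset ↔ SameBlock S c x := by
    intro c x
    rw [Set.Finite.mem_toFinset]
    rfl
  refine cellBound_card _ _ _ (by simpa using hne) ?_ ?_ ?_
  · intro φ hφ
    obtain ⟨-, -, ⟨x, y, hx, hy, h⟩, -⟩ := (Set.Finite.mem_toFinset _).1 hφ
    exact ⟨x, (memB _ _).2 hx, y, (memB _ _).2 hy, h⟩
  · intro x hx x' hx'
    rw [memB] at hx hx'
    have hxx := sameBlock_trans hsub hx.symm hx'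
    have hxU := (hU a ha).2 x hx
    have hxU' := (hU a ha).2 x' hx'
    obtain ⟨g, hg, hgW, hgx⟩ := exists_within hsub hst hxx.1
    rw [(hU x hxU).1, (hU x' hxU').1] at hgW
    obtain ⟨hfw, hbw⟩ := class_perm hsub hU hg hxU hxx hgx
    refine ⟨g, hgx, fun w hw => ?_, fun φ hφ => ?_⟩
    · rw [memB] at hw
      obtain ⟨v, -, hv, hwv⟩ := hfw w ((hU a ha).2 w hw)
      exact ⟨v, (memB _ _).2 (sameBlock_trans hsub hw hwv), hv⟩
    · rw [Set.Finite.mem_toFinset] at hφ ⊢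
      obtain ⟨hφS, hφW, ⟨x₁, y₁, hx₁, hy₁, h₁⟩, hφR⟩ := hφ
      refine ⟨⟨hsub _ hg _ hφS, ?_, ?_, ?_⟩, ?_⟩
      · intro w z h
        obtain ⟨v, h2, h3⟩ := of_trans_apply h
        exact ⟨(hgW _ _ h2).1, (hφW _ _ h3).2⟩
      · obtain ⟨v, -, hv, hvx⟩ := hbw x₁ ((hU a ha).2 x₁ hx₁)
        exact ⟨v, y₁, sameBlock_trans hsub hx₁ hvx.symm, hy₁, trans_apply hv h₁⟩
      · intro w z h
        obtain ⟨v, h2, h3⟩ := of_trans_apply h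
        obtain ⟨v', -, h4, h5⟩ := hfw w (hgW _ _ h2).1
        obtain rfl := eq_of_apply h2 h4
        exact hR _ _ _ _ h5.symm (hrefl z) (hφR _ _ h3)
      · refine ext_graph fun w z => ⟨fun h => ?_, fun h => ?_⟩
        · obtain ⟨v, h2, h3⟩ := of_trans_apply h
          obtain ⟨v', h4, h5⟩ := of_trans_apply h3
          rw [PEquiv.eq_some_iff] at h2
          obtain rfl := eq_of_apply h2 h4
          exact h5
        · obtain ⟨v, -, hv, -⟩ := hbw w (hφW _ _ h).1
          exact trans_apply ((PEquiv.eq_some_iff g).2 hv) (trans_apply hv h)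
  · intro y hy y' hy'
    rw [memB] at hy hy'
    have hyy := sameBlock_trans hsub hy.symm hy'
    have hyV := (hV b hb).2 y hy
    have hyV' := (hV b hb).2 y' hy'
    obtain ⟨k, hk, hkW, hky⟩ := exists_within hsub hst hyy.1
    rw [(hV y hyV).1, (hV y' hyV').1] at hkW
    obtain ⟨hfw, hbw⟩ := class_perm hsub hV hk hyV hyy hky
    refine ⟨k, hky, fun w hw => ?_, fun φ hφ => ?_⟩
    · rw [memB] at hw
      obtain ⟨v, -, hv, hwv⟩ := hbw w ((hV b hb).2 w hw)
      exact ⟨v, (memB _ _).2 (sameBlock_trans hsub hw hwv.symm), hv⟩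
    · rw [Set.Finite.mem_toFinset] at hφ ⊢
      obtain ⟨hφS, hφW, ⟨x₁, y₁, hx₁, hy₁, h₁⟩, hφR⟩ := hφ
      refine ⟨⟨hsub _ hφS _ hk, ?_, ?_, ?_⟩, ?_⟩
      · intro w z h
        obtain ⟨v, h2, h3⟩ := of_trans_apply h
        exact ⟨(hφW _ _ h2).1, (hkW _ _ h3).2⟩
      · obtain ⟨v, -, hv, hyv⟩ := hfw y₁ ((hV b hb).2 y₁ hy₁)
        exact ⟨x₁, v, hx₁, sameBlock_trans hsub hy₁ hyv, trans_apply h₁ hv⟩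
      · intro w z h
        obtain ⟨v, h2, h3⟩ := of_trans_apply h
        obtain ⟨v', -, h4, h5⟩ := hfw v (hkW _ _ h3).1
        obtain rfl := eq_of_apply h3 h4
        exact hR _ _ _ _ (hrefl w) h5 (hφR _ _ h2)
      · refine ext_graph fun w z => ⟨fun h => ?_, fun h => ?_⟩
        · obtain ⟨v, h2, h3⟩ := of_trans_apply h
          obtain ⟨v', h4, h5⟩ := of_trans_apply h2
          rw [PEquiv.eq_some_iff] at h3
          obtain rfl := eq_of_map_eq h3 h5
          exact h4
        · obtain ⟨v, -, hv, -⟩ := hfw z (hφW _ _ h).2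
          exact trans_apply (trans_apply h hv) ((PEquiv.eq_some_iff k).2 hv)

lemma exists_top (hsub : IsSubsemigroup S) (hst : Semitransitive S) {Z : Set (Fin n)}
    (hZ : Z.Nonempty) : ∃ z₀ ∈ Z, ∀ z ∈ Z, STGe S z₀ z := by
  obtain ⟨z₀, hz₀, hmax⟩ := Set.exists_max_image Z (fun z => {u | STGe S z u}.ncard)
    (Set.toFinite _) hZ
  refine ⟨z₀, hz₀, fun z hz => ?_⟩
  rcases stge_total hst z₀ z with h | h
  · exact h
  · have hss : {u | STGe S z₀ u} ⊆ {u | STGe S z u} := fun u hu => stge_trans hsub h hu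
    have := Set.eq_of_subset_of_ncard_le hss (hmax z hz) (Set.toFinite _)
    have hz' : z ∈ {u | STGe S z u} := stge_refl hst z
    rwa [← this] at hz'

lemma exists_bottom (hsub : IsSubsemigroup S) (hst : Semitransitive S) {Z : Set (Fin n)}
    (hZ : Z.Nonempty) : ∃ z₀ ∈ Z, ∀ z ∈ Z, STGe S z z₀ := by
  obtain ⟨z₀, hz₀, hmax⟩ := Set.exists_max_image Z (fun z => {u | STGe S u z}.ncard)
    (Set.toFinite _) hZ
  refine ⟨z₀, hz₀, fun z hz => ?_⟩
  rcases stge_total hst z₀ z with h | h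
  · have hss : {u | STGe S u z₀} ⊆ {u | STGe S u z} := fun u hu => stge_trans hsub hu h
    have := Set.eq_of_subset_of_ncard_le hss (hmax z hz) (Set.toFinite _)
    have hz' : z ∈ {u | STGe S u z} := stge_refl hst z
    rwa [← this] at hz'
  · exact h

/-- `β` strictly descends in the semitransitivity preorder. -/
def Descends (S : Set (ISemi n)) (β : ISemi n) : Prop := ∀ ℓ z, β ℓ = some z → ¬ STGe S z ℓ

lemma exists_descends (hsub : IsSubsemigroup S) (hst : Semitransitive S) {V : Set (Fin n)}
    (hV : IsClass S V) {c d : Fin n} (hc : c ∈ V) (hd : d ∈ V) (hcd : ¬ STGe S d c) :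
    ∃ β ∈ S, Within V V β ∧ β c = some d ∧ Descends S β := by
  obtain ⟨β, hβ, hW, hβc⟩ :=
    exists_within hsub hst ((stge_total hst c d).resolve_right hcd)
  rw [(hV c hc).1, (hV d hd).1] at hW
  refine ⟨β, hβ, hW, hβc, fun ℓ z h hz => hcd ?_⟩
  obtain ⟨v, hv, hb⟩ := total_on_core hsub hβ h hz
    ((hV ℓ (hW _ _ h).1).1.symm ▸ hc : c ∈ core S ℓ)
  obtain rfl := eq_of_apply hβc hv
  exact hb.2

lemma within_trans {U V W : Set (Fin n)} {φ ψ : ISemi n} (h : Within U V φ) (h' : Within V W ψ) :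
    Within U W (φ.trans ψ) := by
  intro w z hwz
  obtain ⟨v, h1, h2⟩ := of_trans_apply hwz
  exact ⟨(h _ _ h1).1, (h' _ _ h2).2⟩

/-- No point of the block of `a` is related to a point strictly above `b`. -/
def HighestImage (S : Set (ISemi n)) (a b w z : Fin n) : Prop :=
  ¬ (SameBlock S a w ∧ STGe S z b ∧ ¬ STGe S b z)

/-- No point strictly below `a` is related to a point of the block of `b`. -/
def LowestPreimage (S : Set (ISemi n)) (a b w z : Fin n) : Prop :=
  ¬ (SameBlock S b z ∧ STGe S a w ∧ ¬ STGe S w a)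

lemma exists_highestImage (hsub : IsSubsemigroup S) (hst : Semitransitive S)
    {U V : Set (Fin n)} (hV : IsClass S V) {a b : Fin n} (hb : b ∈ V) (Q : ISemi n → Prop)
    (hQ : ∀ φ β, Within U V φ → Within V V β → Descends S β → Q φ → Q (φ.trans β))
    (h : ∃ φ ∈ S, Within U V φ ∧ φ a = some b ∧ Q φ) :
    ∃ φ ∈ S, Within U V φ ∧ (∃ x y, SameBlock S a x ∧ SameBlock S b y ∧ φ x = some y) ∧ Q φ ∧
      ∀ w z, φ w = some z → HighestImage S a b w z := by
  have hrefl : ∀ z, SameBlock S z z := fun z => ⟨stge_refl hst z, stge_refl hst z⟩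
  let D : ISemi n → Set (Fin n) := fun φ =>
    {u | ∃ w z, SameBlock S a w ∧ φ w = some z ∧ STGe S z u}
  obtain ⟨φ₀, h1, h2, h3, h4⟩ := h
  obtain ⟨φ, ⟨hφ, hW, hm, hq⟩, hmin⟩ := Set.exists_min_image
    {φ | φ ∈ S ∧ Within U V φ ∧ (∃ x y, SameBlock S a x ∧ SameBlock S b y ∧ φ x = some y) ∧ Q φ}
    (fun φ => (D φ).ncard) (Set.toFinite _) ⟨φ₀, h1, h2, ⟨a, b, hrefl a, hrefl b, h3⟩, h4⟩
  refine ⟨φ, hφ, hW, hm, hq, ?_⟩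
  rintro w z hwz ⟨hw, hzb, hbz⟩
  obtain ⟨z₀, ⟨w₀, hw₀, hwz₀⟩, htop⟩ := exists_top hsub hst
    (Z := {z | ∃ w, SameBlock S a w ∧ φ w = some z}) ⟨z, w, hw, hwz⟩
  have hz₀ : ¬ STGe S b z₀ := fun h => hbz (stge_trans hsub h (htop z ⟨w, hw, hwz⟩))
  obtain ⟨β, hβ, hβW, hβz, hdesc⟩ := exists_descends hsub hst hV (hW _ _ hwz₀).2 hb hz₀
  have hle := hmin (φ.trans β) ⟨hsub _ hφ _ hβ, within_trans hW hβW,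
    ⟨w₀, b, hw₀, hrefl b, trans_apply hwz₀ hβz⟩, hQ _ _ hW hβW hdesc hq⟩
  refine absurd hle (not_le.2 (Set.ncard_lt_ncard ⟨?_, fun hss => ?_⟩ (Set.toFinite _)))
  · rintro u ⟨w', z', hw', h, hu⟩
    obtain ⟨ℓ, h5, h6⟩ := of_trans_apply h
    exact ⟨w', ℓ, hw', h5, stge_trans hsub ⟨β, hβ, h6⟩ hu⟩
  · obtain ⟨w', z', hw', h, hu⟩ := hss (⟨w₀, z₀, hw₀, hwz₀, stge_refl hst z₀⟩ : z₀ ∈ D φ)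
    obtain ⟨ℓ, h5, h6⟩ := of_trans_apply h
    exact hdesc _ _ h6 (stge_trans hsub hu (htop ℓ ⟨w', hw', h5⟩))

lemma exists_lowestPreimage (hsub : IsSubsemigroup S) (hst : Semitransitive S)
    {U V : Set (Fin n)} (hU : IsClass S U) {a b : Fin n} (ha : a ∈ U)
    (h : ∃ φ ∈ S, Within U V φ ∧ φ a = some b) :
    ∃ φ ∈ S, Within U V φ ∧ (∃ x y, SameBlock S a x ∧ SameBlock S b y ∧ φ x = some y) ∧
      ∀ w z, φ w = some z → LowestPreimage S a b w z := by
  have hrefl : ∀ z, SameBlock S z z := fun z => ⟨stge_refl hst z, stge_refl hst z⟩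
  let D : ISemi n → Set (Fin n) := fun φ =>
    {u | ∃ w z, SameBlock S b z ∧ φ w = some z ∧ STGe S u w}
  obtain ⟨φ₀, h1, h2, h3⟩ := h
  obtain ⟨φ, ⟨hφ, hW, hm⟩, hmin⟩ := Set.exists_min_image
    {φ | φ ∈ S ∧ Within U V φ ∧ ∃ x y, SameBlock S a x ∧ SameBlock S b y ∧ φ x = some y}
    (fun φ => (D φ).ncard) (Set.toFinite _) ⟨φ₀, h1, h2, ⟨a, b, hrefl a, hrefl b, h3⟩⟩
  refine ⟨φ, hφ, hW, hm, ?_⟩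
  rintro w z hwz ⟨hz, haw, hwa⟩
  obtain ⟨w₀, ⟨z₀, hz₀, hwz₀⟩, hbot⟩ := exists_bottom hsub hst
    (Z := {w | ∃ z, SameBlock S b z ∧ φ w = some z}) ⟨w, z, hz, hwz⟩
  have hw₀ : ¬ STGe S w₀ a := fun h => hwa (stge_trans hsub (hbot w ⟨z, hz, hwz⟩) h)
  obtain ⟨α, hα, hαW, hαa, hdesc⟩ := exists_descends hsub hst hU ha (hW _ _ hwz₀).1 hw₀
  have hle := hmin (α.trans φ) ⟨hsub _ hα _ hφ, within_trans hαW hW,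
    ⟨a, z₀, hrefl a, hz₀, trans_apply hαa hwz₀⟩⟩
  refine absurd hle (not_le.2 (Set.ncard_lt_ncard ⟨?_, fun hss => ?_⟩ (Set.toFinite _)))
  · rintro u ⟨w', z', hz', h, hu⟩
    obtain ⟨ℓ, h5, h6⟩ := of_trans_apply h
    exact ⟨ℓ, z', hz', h6, stge_trans hsub hu ⟨α, hα, h5⟩⟩
  · obtain ⟨w', z', hz', h, hu⟩ := hss (⟨w₀, z₀, hz₀, hwz₀, stge_refl hst w₀⟩ : w₀ ∈ D φ)
    obtain ⟨ℓ, h5, h6⟩ := of_trans_apply h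
    exact hdesc _ _ h5 (stge_trans hsub (hbot ℓ ⟨z', hz', h6⟩) hu)

/-- `S` has no injective family of `2n` arrows, since it also contains the empty map. -/
lemma not_exists_arrows (hn : 1 ≤ n) (hsub : IsSubsemigroup S) (hsing : ∀ φ ∈ S, IsSingular φ)
    (hst : Semitransitive S) (hcard : S.ncard ≤ 2 * n) (s t : Fin n × Bool → Fin n)
    (h : ∀ p, STGe S (s p) (t p))
    (hinj : ∀ p q, core S (s p) = core S (s q) → core S (t p) = core S (t q) →
      (s p = s q ↔ t p = t q) → p = q) : False := by
  choose f hf hW hm using fun p => exists_within hsub hst (h p)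
  have hfinj : Function.Injective f := by
    intro p q hpq
    have hq := hm q
    have hp := hm p
    have e1 := hW q _ _ (hpq ▸ hp)
    have e2 := hW p _ _ (hpq ▸ hq)
    refine hinj p q (core_eq e2.1 e1.1) (core_eq e2.2 e1.2)
      ⟨fun e => ?_, fun e => ?_⟩
    · rw [← hpq, ← e] at hq
      exact eq_of_apply hp hq
    · rw [← hpq, ← e] at hq
      exact eq_of_map_eq hp hq
  have hbot : ⊥ ∉ Set.range f := by
    rintro ⟨p, hp⟩
    have := hm p
    rw [hp] at this
    simp at this
  have h1 : (insert ⊥ (Set.range f)).ncard = 2 * n + 1 := by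
    rw [Set.ncard_insert_of_notMem hbot (Set.toFinite _), ← Set.image_univ,
      Set.ncard_image_of_injective _ hfinj, Set.ncard_univ, Nat.card_eq_fintype_card]
    simp [mul_comm]
  have h2 : insert ⊥ (Set.range f) ⊆ S := by
    rintro φ (rfl | ⟨p, rfl⟩)
    · exact bot_mem hn hsub hsing hst
    · exact hf p
  have := Set.ncard_le_ncard h2 (Set.toFinite _)
  omega

lemma core_eq_of_tops (hn : 1 ≤ n) (hsub : IsSubsemigroup S) (hsing : ∀ φ ∈ S, IsSingular φ)
    (hst : Semitransitive S) (hcard : S.ncard ≤ 2 * n) {x x' : Fin n} (hx : ∀ w, STGe S x w)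
    (hx' : ∀ w, STGe S x' w) : core S x = core S x' := by
  by_contra hne
  refine not_exists_arrows hn hsub hsing hst hcard (fun p => if p.2 then x else x')
    (fun p => p.1) ?_ ?_
  · rintro ⟨w, _ | _⟩ <;> simp [hx, hx']
  · rintro ⟨w, _ | _⟩ ⟨w', _ | _⟩ <;> simp [hne, Ne.symm hne]

lemma core_cases (hn : 1 ≤ n) (hsub : IsSubsemigroup S) (hsing : ∀ φ ∈ S, IsSingular φ)
    (hst : Semitransitive S) (hcard : S.ncard ≤ 2 * n) {x₁ x₂ : Fin n}
    (h12 : core S x₂ ≠ core S x₁) (x₃ : Fin n) :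
    core S x₃ = core S x₁ ∨ core S x₃ = core S x₂ := by
  classical
  by_contra! hne
  obtain ⟨h31, h32⟩ := hne
  obtain ⟨T', hT1, hT2, hT3⟩ : ∃ T' : Fin n → Fin n, (∀ w, core S (T' w) = core S w) ∧
      (∀ w, STGe S (T' w) w) ∧ ∀ w w', core S w = core S w' → T' w = T' w' := by
    have key : ∀ C : Set (Fin n), ∃ u, ∀ w, core S w = C → core S u = C ∧ STGe S u w := by
      intro C
      by_cases hC : ∃ w, core S w = C
      · obtain ⟨w, rfl⟩ := hC
        obtain ⟨u, hu, hu'⟩ := exists_top hsub hst (Z := {u | core S u = core S w}) ⟨w, rfl⟩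
        exact ⟨u, fun w' hw' => ⟨hu, hu' w' hw'⟩⟩
      · exact ⟨x₁, fun w hw => (hC ⟨w, hw⟩).elim⟩
    choose u hu using key
    exact ⟨fun w => u (core S w), fun w => (hu _ w rfl).1, fun w => (hu _ w rfl).2,
      fun w w' h => congrArg u h⟩
  let r : Fin n → Fin n := fun w =>
    if core S w = core S x₁ then x₂ else if core S w = core S x₂ then x₃ else x₁
  have hr1 : ∀ w w', core S w = core S w' → r w = r w' := fun w w' h => by simp [r, h]
  have hr2 : ∀ w, core S (r w) ≠ core S w := by
    intro w
    simp only [r]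
    split_ifs <;> grind
  have hr3 : ∀ w w', core S w = core S (r w') → core S (r w) ≠ core S w' := by
    intro w w'
    simp only [r]
    split_ifs <;> grind
  clear_value r
  refine not_exists_arrows hn hsub hsing hst hcard
    (fun p => if p.2 then T' p.1 else if STGe S p.1 (r p.1) then p.1 else r p.1)
    (fun p => if p.2 then p.1 else if STGe S p.1 (r p.1) then r p.1 else p.1) ?_ ?_
  · rintro ⟨w, _ | _⟩
    · by_cases h : STGe S w (r w)
      · simp [h]
      · simpa [h] using (stge_total hst w (r w)).resolve_left h
    · simpa using hT2 w
  · rintro ⟨w, _ | _⟩ ⟨w', _ | _⟩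
    · have e1 := hr1 w w'
      have e2 := hr2 w
      have e3 := hr2 w'
      have e4 := hr3 w w'
      simp only [if_false, Bool.false_eq_true]
      intro h1 h2 h3
      split_ifs at h1 h2 h3 <;> grind -ext
    · have e1 := hr2 w
      have e2 := hT1 w'
      simp only [if_true, if_false, Bool.false_eq_true]
      intro h1 h2 h3
      split_ifs at h1 h2 h3 <;> grind -ext
    · have e1 := hr2 w'
      have e2 := hT1 w
      simp only [if_true, if_false, Bool.false_eq_true]
      intro h1 h2 h3
      split_ifs at h1 h2 h3 <;> grind -ext
    · intro _ h2 h3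
      simp only [if_true] at h2 h3 ⊢
      rw [h3.1 (hT3 w w' h2)]

lemma exists_notMem_core (hsub : IsSubsemigroup S) (hsing : ∀ φ ∈ S, IsSingular φ)
    (hst : Semitransitive S) (x : Fin n) : ∃ u, u ∉ core S x := by
  obtain ⟨e, he, h⟩ := exists_core_id hsub hst x
  obtain ⟨u, hu⟩ := hsing e he
  exact ⟨u, fun hmem => by simp [(h u u).2 ⟨rfl, hmem⟩] at hu⟩

/-- The points of `Fin n` fall into two classes `A` and `B`, with tops `x₁` and `x₂`. -/
lemma exists_classes (hn : 1 ≤ n) (hsub : IsSubsemigroup S) (hsing : ∀ φ ∈ S, IsSingular φ)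
    (hst : Semitransitive S) (hcard : S.ncard ≤ 2 * n) :
    ∃ (A B : Set (Fin n)) (x₁ x₂ : Fin n), IsClass S A ∧ IsClass S B ∧ B = Aᶜ ∧ x₁ ∈ A ∧ x₂ ∈ B ∧
      (∀ w, STGe S x₁ w) ∧ ∀ w ∈ B, STGe S x₂ w := by
  obtain ⟨x₁, -, hx₁⟩ := exists_top hsub hst (Z := Set.univ) ⟨⟨0, hn⟩, trivial⟩
  have htop : ∀ w, STGe S x₁ w := fun w => hx₁ w trivial
  obtain ⟨u, hu⟩ := exists_notMem_core hsub hsing hst x₁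
  obtain ⟨x₂, hx₂, htop₂⟩ := exists_top hsub hst (Z := {x | core S x ≠ core S x₁})
    ⟨u, fun h => hu (h ▸ mem_core_self u)⟩
  have hcases := core_cases hn hsub hsing hst hcard hx₂
  have key : ∀ y z, (∀ x, core S x = core S y ∨ core S x = core S z) →
      ∀ x ∈ core S y, core S x = core S y := by
    intro y z hyz x hx
    refine (hyz x).resolve_right fun h => ?_
    obtain ⟨v, hv⟩ := exists_notMem_core hsub hsing hst y
    rcases hyz v with h' | h'
    · exact hv (h' ▸ mem_core_self v)
    · exact hv (core_subset hx (h ▸ h' ▸ mem_core_self v))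
  have hA := key x₁ x₂ hcases
  have hB := key x₂ x₁ fun x => (hcases x).symm
  have hAiff : ∀ x, x ∈ core S x₁ ↔ core S x = core S x₁ :=
    fun x => ⟨hA x, fun h => h ▸ mem_core_self x⟩
  have hBiff : ∀ x, x ∈ core S x₂ ↔ core S x = core S x₂ :=
    fun x => ⟨hB x, fun h => h ▸ mem_core_self x⟩
  have hcompl : core S x₂ = (core S x₁)ᶜ := by
    ext x
    rw [Set.mem_compl_iff, hAiff, hBiff]
    exact ⟨fun h => h ▸ hx₂, fun h => (hcases x).resolve_left h⟩
  have htop₂' : ∀ w ∈ core S x₂, STGe S x₂ w := fun w hw =>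
    htop₂ w (by rw [Set.mem_ofPred_eq, hB w hw]; exact hx₂)
  have hsplit : ∀ a ∈ core S x₁, ∀ b ∈ core S x₂, ¬ SameBlock S a b := by
    intro a ha b hb hab
    obtain ⟨φ, hφ, hW, hm⟩ := exists_within hsub hst hab.1
    obtain ⟨v, hv, hvb⟩ := total_on_core hsub hφ hm hab.2
      (w := x₁) (by rw [hA a ha]; exact mem_core_self x₁)
    have hvB : v ∈ core S x₂ := by
      have := (hW _ _ hv).2
      rwa [hB b hb] at this
    exact hx₂ (core_eq_of_tops hn hsub hsing hst hcard
      (fun w => stge_trans hsub (htop₂' v hvB) (stge_trans hsub hvb.2 (htop w))) htop)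
  refine ⟨core S x₁, core S x₂, x₁, x₂, fun x hx => ⟨hA x hx, fun y hxy => ?_⟩,
    fun x hx => ⟨hB x hx, fun y hxy => ?_⟩, hcompl, mem_core_self _, mem_core_self _, htop, htop₂'⟩
  · by_contra h
    exact hsplit x hx y (hcompl ▸ h) hxy
  · by_contra h
    exact hsplit y (by simpa [hcompl] using h) x hx hxy.symm

lemma cellBound_comm {o p N : ℕ} (h : CellBound o p N) : CellBound p o N :=
  ⟨h.2.1, h.1, fun hN => (h.2.2 (by rwa [max_comm])).symm⟩

lemma cell_subset {U V : Set (Fin n)} {a b : Fin n} {R : Fin n → Fin n → Prop} :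
    cell S U V a b R ⊆ S \ {⊥} := by
  rintro φ ⟨hφ, -, ⟨x, y, -, -, h⟩, -⟩
  refine ⟨hφ, ?_⟩
  rintro rfl
  simp at h

lemma nonempty_of_mem_cells {U V U' V' : Set (Fin n)} {a b a' b' : Fin n}
    {R R' : Fin n → Fin n → Prop} {φ : ISemi n} (h : φ ∈ cell S U V a b R)
    (h' : φ ∈ cell S U' V' a' b' R') : (U ∩ U').Nonempty ∧ (V ∩ V').Nonempty := by
  obtain ⟨-, hW, ⟨x, y, -, -, hm⟩, -⟩ := h
  have h1 := hW _ _ hm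
  have h2 := h'.2.1 _ _ hm
  exact ⟨⟨x, h1.1, h2.1⟩, ⟨y, h1.2, h2.2⟩⟩

lemma stge_of_highestImage (hsub : IsSubsemigroup S) (hst : Semitransitive S)
    {U V U' V' : Set (Fin n)} {a b b' : Fin n} {R R' : Fin n → Fin n → Prop}
    (hR' : ∀ w z, R' w z → HighestImage S a b' w z) {φ : ISemi n} (h : φ ∈ cell S U V a b R)
    (h' : φ ∈ cell S U' V' a b' R') : STGe S b' b := by
  obtain ⟨-, -, ⟨x, y, hx, hy, hm⟩, -⟩ := h
  have h1 := hR' _ _ (h'.2.2.2 _ _ hm)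
  by_contra hb
  have h2 : ¬ STGe S b' y := fun h => hb (stge_trans hsub h hy.2)
  exact h1 ⟨hx, (stge_total hst y b').resolve_right h2, h2⟩

lemma sameBlock_of_highestImage (hsub : IsSubsemigroup S) (hst : Semitransitive S)
    {U V U' V' : Set (Fin n)} {a b b' : Fin n} {R R' : Fin n → Fin n → Prop}
    (hR : ∀ w z, R w z → HighestImage S a b w z) (hR' : ∀ w z, R' w z → HighestImage S a b' w z)
    {φ : ISemi n} (h : φ ∈ cell S U V a b R) (h' : φ ∈ cell S U' V' a b' R') :
    SameBlock S b b' :=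
  ⟨stge_of_highestImage hsub hst hR h' h, stge_of_highestImage hsub hst hR' h h'⟩

lemma stge_of_lowestPreimage (hsub : IsSubsemigroup S) (hst : Semitransitive S)
    {U V U' V' : Set (Fin n)} {a a' b : Fin n} {φ : ISemi n}
    (h : φ ∈ cell S U V a b (LowestPreimage S a b))
    (h' : φ ∈ cell S U' V' a' b (LowestPreimage S a' b)) : STGe S a a' := by
  obtain ⟨-, -, ⟨x, y, hx, hy, hm⟩, -⟩ := h
  have h1 := h'.2.2.2 _ _ hm
  by_contra hb
  have h2 : ¬ STGe S x a' := fun h => hb (stge_trans hsub hx.1 h)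
  exact h1 ⟨hy, (stge_total hst a' x).resolve_right h2, h2⟩

lemma sameBlock_of_lowestPreimage (hsub : IsSubsemigroup S) (hst : Semitransitive S)
    {U V U' V' : Set (Fin n)} {a a' b : Fin n} {φ : ISemi n}
    (h : φ ∈ cell S U V a b (LowestPreimage S a b))
    (h' : φ ∈ cell S U' V' a' b (LowestPreimage S a' b)) : SameBlock S a a' :=
  ⟨stge_of_lowestPreimage hsub hst h h', stge_of_lowestPreimage hsub hst h' h⟩

lemma highestImage_congr (hsub : IsSubsemigroup S) {a b w w' z z' : Fin n}
    (hw : SameBlock S w w') (hz : SameBlock S z z') (h : HighestImage S a b w z) :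
    HighestImage S a b w' z' := fun h' => h ⟨sameBlock_trans hsub h'.1 hw.symm,
      stge_trans hsub hz.1 h'.2.1, fun h2 => h'.2.2 (stge_trans hsub h2 hz.1)⟩

lemma lowestPreimage_congr (hsub : IsSubsemigroup S) {a b w w' z z' : Fin n}
    (hw : SameBlock S w w') (hz : SameBlock S z z') (h : LowestPreimage S a b w z) :
    LowestPreimage S a b w' z' := fun h' => h ⟨sameBlock_trans hsub h'.1 hz.symm,
      stge_trans hsub h'.2.1 hw.2, fun h2 => h'.2.2 (stge_trans hsub hw.2 h2)⟩

lemma exists_within_classes (hsub : IsSubsemigroup S) (hst : Semitransitive S)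
    {U V : Set (Fin n)} (hU : IsClass S U) (hV : IsClass S V) {a b : Fin n} (ha : a ∈ U)
    (hb : b ∈ V) (h : STGe S a b) : ∃ φ ∈ S, Within U V φ ∧ φ a = some b := by
  obtain ⟨φ, hφ, hW, hm⟩ := exists_within hsub hst h
  rw [(hU a ha).1, (hV b hb).1] at hW
  exact ⟨φ, hφ, hW, hm⟩

lemma cellBound_highestImage (hsub : IsSubsemigroup S) (hst : Semitransitive S)
    {U V : Set (Fin n)} (hU : IsClass S U) (hV : IsClass S V) {a b : Fin n} (ha : a ∈ U)
    (hb : b ∈ V) (h : STGe S a b) :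
    CellBound (STBlock S a).ncard (STBlock S b).ncard
      (cell S U V a b (HighestImage S a b)).ncard := by
  refine cellBound_cell hsub hst hU hV ha hb
    (fun w w' z z' hw hz => highestImage_congr hsub hw hz) ?_
  obtain ⟨φ, hφ, hW, hm⟩ := exists_within_classes hsub hst hU hV ha hb h
  obtain ⟨ψ, h1, h2, h3, -, h4⟩ := exists_highestImage hsub hst hV hb (fun _ => True)
    (fun _ _ _ _ _ _ => trivial) ⟨φ, hφ, hW, hm, trivial⟩
  exact ⟨ψ, h1, h2, h3, h4⟩

lemma cellBound_lowestPreimage (hsub : IsSubsemigroup S) (hst : Semitransitive S)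
    {U V : Set (Fin n)} (hU : IsClass S U) (hV : IsClass S V) {a b : Fin n} (ha : a ∈ U)
    (hb : b ∈ V) (h : STGe S a b) :
    CellBound (STBlock S a).ncard (STBlock S b).ncard
      (cell S U V a b (LowestPreimage S a b)).ncard := by
  refine cellBound_cell hsub hst hU hV ha hb
    (fun w w' z z' hw hz => lowestPreimage_congr hsub hw hz) ?_
  obtain ⟨ψ, h1, h2, h3, h4⟩ := exists_lowestPreimage hsub hst hU ha
    (exists_within_classes hsub hst hU hV ha hb h)
  exact ⟨ψ, h1, h2, h3, h4⟩

lemma cellBound_highestImage_below (hsub : IsSubsemigroup S) (hst : Semitransitive S)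
    {U V : Set (Fin n)} (hU : IsClass S U) (hV : IsClass S V) {a b c : Fin n} (ha : a ∈ U)
    (hb : b ∈ V) (hc : c ∈ V) (hac : STGe S a c) (htop : ∀ w ∈ V, STGe S c w)
    (hcb : ¬ SameBlock S c b) :
    CellBound (STBlock S a).ncard (STBlock S b).ncard
      (cell S U V a b fun w z => HighestImage S a b w z ∧ ¬ SameBlock S c z).ncard := by
  refine cellBound_cell hsub hst hU hV ha hb (fun w w' z z' hw hz h =>
    ⟨highestImage_congr hsub hw hz h.1, fun h' => h.2 (sameBlock_trans hsub h' hz.symm)⟩) ?_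
  have hQ : ∀ φ β, Within U V φ → Within V V β → Descends S β →
      ∀ w z, (φ.trans β) w = some z → ¬ SameBlock S c z := by
    intro φ β _ hβ hd w z h hz
    obtain ⟨v, -, hv⟩ := of_trans_apply h
    exact hd _ _ hv (stge_trans hsub hz.2 (htop v (hβ _ _ hv).1))
  obtain ⟨φ, hφ, hW, hm⟩ := exists_within_classes hsub hst hU hV ha hc hac
  obtain ⟨β, hβ, hβW, hβm, hd⟩ :=
    exists_descends hsub hst hV hc hb fun h => hcb ⟨htop b hb, h⟩
  obtain ⟨ψ, h1, h2, h3, hq, h4⟩ := exists_highestImage hsub hst hV hb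
    (fun φ => ∀ w z, φ w = some z → ¬ SameBlock S c z) (fun φ β h h' hd _ => hQ φ β h h' hd)
    ⟨φ.trans β, hsub _ hφ _ hβ, within_trans hW hβW, trans_apply hm hβm, hQ φ β hW hβW hd⟩
  exact ⟨ψ, h1, h2, h3, fun w z h => ⟨h4 w z h, hq w z h⟩⟩

/-- A family of subsets of `S`, disjoint up to the choice of representatives of the blocks,
satisfying the cell bounds with respect to the two top blocks. -/
lemma exists_cells (hsub : IsSubsemigroup S) (hst : Semitransitive S)
    {A B : Set (Fin n)} (hA : IsClass S A) (hB : IsClass S B) (hAB : B = Aᶜ) {x₁ x₂ : Fin n}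
    (h₁ : x₁ ∈ A) (h₂ : x₂ ∈ B) (htop₁ : ∀ w, STGe S x₁ w) (htop₂ : ∀ w ∈ B, STGe S x₂ w) :
    ∃ F : Fin n × Bool → Set (ISemi n), (∀ p, F p ⊆ S \ {⊥}) ∧
      (∀ p q φ, φ ∈ F p → φ ∈ F q → SameBlock S p.1 q.1 ∧ p.2 = q.2) ∧
      (∀ b ∈ A, CellBound (STBlock S x₁).ncard (STBlock S b).ncard (F (b, true)).ncard ∧
        CellBound (STBlock S x₂).ncard (STBlock S b).ncard (F (b, false)).ncard) ∧
      (∀ b ∈ B, CellBound (STBlock S x₂).ncard (STBlock S b).ncard (F (b, true)).ncard ∧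
        (¬ SameBlock S x₂ b →
          CellBound (STBlock S x₁).ncard (STBlock S b).ncard (F (b, false)).ncard)) := by
  classical
  have hdisj : ¬ (A ∩ B).Nonempty := by
    rintro ⟨x, hx, hx'⟩
    rw [hAB] at hx'
    exact hx' hx
  have hdisj' : ¬ (B ∩ A).Nonempty := by rwa [Set.inter_comm]
  have hmem : ∀ x, x ∉ A → x ∈ B := fun x hx => hAB ▸ hx
  let F₁ : Fin n → Set (ISemi n) := fun b =>
    if b ∈ A then cell S A A x₁ b (HighestImage S x₁ b)
    else cell S B B x₂ b (HighestImage S x₂ b)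
  let F₂ : Fin n → Set (ISemi n) := fun b =>
    if b ∈ A then
      if STGe S b x₂ then cell S A B b x₂ (LowestPreimage S b x₂)
      else cell S B A x₂ b (HighestImage S x₂ b)
    else
      if SameBlock S x₂ b then ∅
      else cell S A B x₁ b fun w z => HighestImage S x₁ b w z ∧ ¬ SameBlock S x₂ z
  have hF₁ : ∀ b, F₁ b ⊆ S \ {⊥} := by
    intro b
    simp only [F₁]
    split_ifs <;> exact cell_subset
  have hF₂ : ∀ b, F₂ b ⊆ S \ {⊥} := by
    intro b
    simp only [F₂]
    split_ifs
    all_goals first | exact cell_subset | exact Set.empty_subset _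
  have h12 : ∀ b c φ, φ ∈ F₁ b → φ ∈ F₂ c → False := by
    intro b c φ hb hc
    simp only [F₁, F₂] at hb hc
    split_ifs at hb hc
    all_goals first
      | exact hc
      | exact hdisj (nonempty_of_mem_cells hb hc).1
      | exact hdisj (nonempty_of_mem_cells hb hc).2
      | exact hdisj' (nonempty_of_mem_cells hb hc).1
      | exact hdisj' (nonempty_of_mem_cells hb hc).2
  have h11 : ∀ b c φ, φ ∈ F₁ b → φ ∈ F₁ c → SameBlock S b c := by
    intro b c φ hb hc
    simp only [F₁] at hb hc
    split_ifs at hb hc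
    all_goals first
      | exact (hdisj (nonempty_of_mem_cells hb hc).1).elim
      | exact (hdisj' (nonempty_of_mem_cells hb hc).1).elim
      | exact sameBlock_of_highestImage hsub hst (fun _ _ h => h) (fun _ _ h => h) hb hc
  have hlow : ∀ b c φ, φ ∈ cell S A B b x₂ (LowestPreimage S b x₂) →
      φ ∉ cell S A B x₁ c (fun w z => HighestImage S x₁ c w z ∧ ¬ SameBlock S x₂ z) := by
    rintro b c φ ⟨-, -, ⟨x, y, -, hy, hm⟩, -⟩ ⟨-, -, -, h⟩
    exact (h _ _ hm).2 hy
  have h22 : ∀ b c φ, φ ∈ F₂ b → φ ∈ F₂ c → SameBlock S b c := by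
    intro b c φ hb hc
    simp only [F₂] at hb hc
    split_ifs at hb hc
    all_goals first
      | exact hb.elim
      | exact hc.elim
      | exact (hdisj (nonempty_of_mem_cells hb hc).1).elim
      | exact (hdisj' (nonempty_of_mem_cells hb hc).1).elim
      | exact (hlow _ _ _ hb hc).elim
      | exact (hlow _ _ _ hc hb).elim
      | exact sameBlock_of_lowestPreimage hsub hst hb hc
      | exact sameBlock_of_highestImage hsub hst (fun _ _ h => h) (fun _ _ h => h) hb hc
      | exact sameBlock_of_highestImage hsub hst (fun _ _ h => h.1) (fun _ _ h => h.1) hb hc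
  refine ⟨fun p => if p.2 then F₁ p.1 else F₂ p.1, ?_, ?_, fun b hb => ?_, fun b hb => ?_⟩
  · rintro ⟨b, _ | _⟩
    · simpa using hF₂ b
    · simpa using hF₁ b
  · rintro ⟨b, _ | _⟩ ⟨c, _ | _⟩ φ hb hc <;>
      simp only [if_true, if_false, Bool.false_eq_true] at hb hc
    · exact ⟨h22 b c φ hb hc, rfl⟩
    · exact (h12 c b φ hc hb).elim
    · exact (h12 b c φ hb hc).elim
    · exact ⟨h11 b c φ hb hc, rfl⟩
  · simp only [if_true, if_false, Bool.false_eq_true, F₁, F₂, hb]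
    refine ⟨cellBound_highestImage hsub hst hA hA h₁ hb (htop₁ b), ?_⟩
    split_ifs with h
    · exact cellBound_comm (cellBound_lowestPreimage hsub hst hA hB hb h₂ h)
    · exact cellBound_highestImage hsub hst hB hA h₂ hb ((stge_total hst b x₂).resolve_left h)
  · have hbA : b ∉ A := fun h => hdisj ⟨b, h, hb⟩
    simp only [if_true, if_false, Bool.false_eq_true, F₁, F₂, hbA]
    refine ⟨cellBound_highestImage hsub hst hB hB h₂ hb (htop₂ b hb), fun h => ?_⟩
    rw [if_neg h]
    exact cellBound_highestImage_below hsub hst hA hB h₁ hb h₂ (htop₁ x₂) htop₂ h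

lemma CellBound.dvd_or_dvd {o p N : ℕ} (h : CellBound o p N) (hN : N < o + p) :
    o ∣ p ∨ p ∣ o := h.2.2 (by omega)

lemma CellBound.dvd_of_lt {o p q N f₁ f₂ : ℕ} (ho : 0 < o) (hp : 0 < p) (hop : o ∣ p)
    (hN : CellBound o p N) (h₁ : CellBound o q f₁) (h₂ : CellBound p q f₂)
    (hlt : N + f₁ + f₂ < o + p + 2 * q) : o ∣ q := by
  have hle := Nat.le_of_dvd hp hop
  obtain ⟨-, hN2, -⟩ := hN
  obtain ⟨h11, -, h13⟩ := h₁
  obtain ⟨h21, h22, -⟩ := h₂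
  rcases h13 (by omega) with h | h
  · exact h
  · have hqo := Nat.le_of_dvd ho h
    rcases hqo.eq_or_lt with rfl | hlt'
    · exact dvd_rfl
    · obtain ⟨k, rfl⟩ := h
      have hk : 2 ≤ k := by
        by_contra! hk
        interval_cases k <;> omega
      nlinarith

lemma exists_representatives (hsub : IsSubsemigroup S) (hst : Semitransitive S) :
    ∃ r : Fin n → Fin n, (∀ x, SameBlock S x (r x)) ∧ ∀ x y, SameBlock S x y → r x = r y := by
  let s : Setoid (Fin n) := ⟨SameBlock S, fun x => ⟨stge_refl hst x, stge_refl hst x⟩,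
    fun h => h.symm, fun h h' => sameBlock_trans hsub h h'⟩
  exact ⟨fun x => (Quotient.mk s x).out,
    fun x => SameBlock.symm (Quotient.exact (Quotient.out_eq (Quotient.mk s x))),
    fun x y h => congrArg Quotient.out (Quotient.sound (s := s) h)⟩

lemma ncard_block_congr (hsub : IsSubsemigroup S) {x y : Fin n} (h : SameBlock S x y) :
    STBlock S x = STBlock S y :=
  Set.ext fun _ => ⟨fun hz => sameBlock_trans hsub h.symm hz, fun hz => sameBlock_trans hsub h hz⟩

/-- Counting the members of a family as in `exists_cells` against `|S| ≤ 2n`. -/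
lemma sum_cells_lt (hn : 1 ≤ n) (hsub : IsSubsemigroup S) (hsing : ∀ φ ∈ S, IsSingular φ)
    (hst : Semitransitive S) (hcard : S.ncard ≤ 2 * n) {F : Fin n × Bool → Set (ISemi n)}
    (hF : ∀ p, F p ⊆ S \ {⊥})
    (hdisj : ∀ p q φ, φ ∈ F p → φ ∈ F q → SameBlock S p.1 q.1 ∧ p.2 = q.2)
    {r : Fin n → Fin n} (hr : ∀ x, SameBlock S x (r x)) (hr' : ∀ x y, SameBlock S x y → r x = r y)
    {T : Finset (Fin n)} (hT : ∀ b ∈ T, r b = b)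
    (hbig : ∀ b, r b = b → b ∉ T →
      2 * (STBlock S b).ncard ≤ (F (b, true)).ncard + (F (b, false)).ncard) :
    ∑ b ∈ T, ((F (b, true)).ncard + (F (b, false)).ncard) <
      ∑ b ∈ T, 2 * (STBlock S b).ncard := by
  classical
  let R := Finset.univ.image r
  have hrr : ∀ b ∈ R, r b = b := by
    intro b hb
    obtain ⟨x, -, rfl⟩ := Finset.mem_image.1 hb
    exact (hr' _ _ (hr x)).symm
  have hTR : T ⊆ R := fun b hb => Finset.mem_image.2 ⟨b, Finset.mem_univ _, hT b hb⟩
  have hsum : ∑ b ∈ R, (STBlock S b).ncard = n := by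
    have h := Finset.card_eq_sum_card_image r Finset.univ
    rw [Finset.card_univ, Fintype.card_fin] at h
    refine Eq.trans (Finset.sum_congr rfl ?_) h.symm
    intro b hb
    rw [← Set.ncard_coe_finset]
    congr 1
    ext x
    simp only [Finset.coe_filter, Finset.mem_univ, true_and]
    constructor
    · intro h
      exact (hr' _ _ h).symm.trans (hrr b hb)
    · rintro rfl
      exact (hr x).symm
  have hFsum : ∑ b ∈ R, ((F (b, true)).ncard + (F (b, false)).ncard) + 1 ≤ S.ncard := by
    have h1 : ∑ p ∈ R ×ˢ Finset.univ, (F p).ncard =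
        ((R ×ˢ Finset.univ).biUnion fun p => (Set.toFinite (F p)).toFinset).card := by
      rw [Finset.card_biUnion]
      · exact Finset.sum_congr rfl fun p _ => Set.ncard_eq_toFinset_card _ _
      · intro p hp q hq hpq
        refine Finset.disjoint_left.2 fun φ h h' => ?_
        rw [Set.Finite.mem_toFinset] at h h'
        obtain ⟨h2, h3⟩ := hdisj p q φ h h'
        refine hpq (Prod.ext ?_ h3)
        rw [← hrr _ (Finset.mem_product.1 hp).1, ← hrr _ (Finset.mem_product.1 hq).1]
        exact hr' _ _ h2
    have h2 : ∑ b ∈ R, ((F (b, true)).ncard + (F (b, false)).ncard) =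
        ∑ p ∈ R ×ˢ Finset.univ, (F p).ncard := by
      rw [Finset.sum_product]
      simp
    rw [h2, h1, ← Set.ncard_coe_finset,
      ← Set.ncard_sdiff_singleton_add_one (bot_mem hn hsub hsing hst)]
    refine Nat.add_le_add_right (Set.ncard_le_ncard ?_ (Set.toFinite _)) 1
    intro φ hφ
    simp only [Finset.coe_biUnion, Set.mem_iUnion, Set.Finite.coe_toFinset] at hφ
    obtain ⟨p, -, hp⟩ := hφ
    exact hF p hp
  have hrest : ∑ b ∈ R \ T, 2 * (STBlock S b).ncard ≤
      ∑ b ∈ R \ T, ((F (b, true)).ncard + (F (b, false)).ncard) :=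
    Finset.sum_le_sum fun b hb => hbig b (hrr b (Finset.mem_sdiff.1 hb).1) (Finset.mem_sdiff.1 hb).2
  have e1 := Finset.sum_sdiff hTR (f := fun b => 2 * (STBlock S b).ncard)
  have e2 := Finset.sum_sdiff hTR (f := fun b => (F (b, true)).ncard + (F (b, false)).ncard)
  have e3 : ∑ b ∈ R, 2 * (STBlock S b).ncard = 2 * n := by rw [← Finset.mul_sum, hsum]
  omega

lemma exists_dvd_blocks (hn : 1 ≤ n) (hsub : IsSubsemigroup S) (hsing : ∀ φ ∈ S, IsSingular φ)
    (hst : Semitransitive S) (hcard : S.ncard ≤ 2 * n) :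
    ∃ z, ∀ x, (STBlock S z).ncard ∣ (STBlock S x).ncard := by
  classical
  obtain ⟨A, B, x₁, x₂, hA, hB, hAB, h₁, h₂, htop₁, htop₂⟩ :=
    exists_classes hn hsub hsing hst hcard
  obtain ⟨F, hF, hdisj, hFA, hFB⟩ := exists_cells hsub hst hA hB hAB h₁ h₂ htop₁ htop₂
  obtain ⟨r, hr, hr'⟩ := exists_representatives hsub hst
  have hrr : ∀ x, r (r x) = r x := fun x => (hr' _ _ (hr x)).symm
  have hpos : ∀ x, 0 < (STBlock S x).ncard := fun x =>
    (Set.ncard_pos (Set.toFinite _)).2 ⟨x, stge_refl hst x, stge_refl hst x⟩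
  have hβr : ∀ x, (STBlock S (r x)).ncard = (STBlock S x).ncard := fun x => by
    rw [ncard_block_congr hsub (hr x)]
  have hne : r x₁ ≠ r x₂ := by
    intro h
    have := (hA x₁ h₁).2 x₂ (sameBlock_trans hsub (h ▸ hr x₁) (hr x₂).symm)
    rw [hAB] at h₂
    exact h₂ this
  have hbound : ∀ b, r b = b → b ≠ r x₁ → b ≠ r x₂ → ∃ f₁ f₂,
      CellBound (STBlock S x₁).ncard (STBlock S b).ncard f₁ ∧
      CellBound (STBlock S x₂).ncard (STBlock S b).ncard f₂ ∧
      f₁ + f₂ = (F (b, true)).ncard + (F (b, false)).ncard := by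
    intro b hb _ hb₂
    by_cases hbA : b ∈ A
    · exact ⟨_, _, (hFA b hbA).1, (hFA b hbA).2, rfl⟩
    · have := hFB b (by rwa [hAB])
      exact ⟨_, _, this.2 fun h => hb₂ (hb.symm.trans (hr' _ _ h).symm), this.1, add_comm _ _⟩
  have hbig : ∀ b, r b = b → b ≠ r x₁ → b ≠ r x₂ →
      2 * (STBlock S b).ncard ≤ (F (b, true)).ncard + (F (b, false)).ncard := by
    intro b hb hb₁ hb₂
    obtain ⟨f₁, f₂, hf₁, hf₂, h⟩ := hbound b hb hb₁ hb₂
    have e1 := hf₁.2.1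
    have e2 := hf₂.2.1
    omega
  have hN₁ := hFA (r x₁) ((hA x₁ h₁).2 _ (hr x₁))
  have hN₂ := (hFB (r x₂) ((hB x₂ h₂).2 _ (hr x₂))).1
  rw [hβr] at hN₁ hN₂
  obtain ⟨⟨hN₁, -, -⟩, hN⟩ := hN₁
  replace hN₂ := hN₂.1
  have hNlt : (F (r x₁, false)).ncard < (STBlock S x₂).ncard + (STBlock S x₁).ncard := by
    have := sum_cells_lt hn hsub hsing hst hcard hF hdisj hr hr' (T := {r x₁, r x₂})
      (by simp [hrr]) fun b hb hbT => by
        simp only [Finset.mem_insert, Finset.mem_singleton, not_or] at hbT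
        exact hbig b hb hbT.1 hbT.2
    rw [Finset.sum_pair hne, Finset.sum_pair hne, hβr, hβr] at this
    omega
  have hother : ∀ b, r b = b → b ≠ r x₁ → b ≠ r x₂ → (F (r x₁, false)).ncard +
      ((F (b, true)).ncard + (F (b, false)).ncard) <
        (STBlock S x₁).ncard + (STBlock S x₂).ncard + 2 * (STBlock S b).ncard := by
    intro b hb hb₁ hb₂
    have := sum_cells_lt hn hsub hsing hst hcard hF hdisj hr hr' (T := {b, r x₁, r x₂})
      (by simp [hrr, hb]) fun b hb hbT => by
        simp only [Finset.mem_insert, Finset.mem_singleton, not_or] at hbT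
        exact hbig b hb hbT.2.1 hbT.2.2
    have hb' : b ∉ ({r x₁, r x₂} : Finset (Fin n)) := by simp [hb₁, hb₂]
    rw [Finset.sum_insert hb', Finset.sum_insert hb', Finset.sum_pair hne, Finset.sum_pair hne,
      hβr, hβr] at this
    omega
  have hreps : ∀ u : ℕ, u ∣ (STBlock S x₁).ncard → u ∣ (STBlock S x₂).ncard →
      (∀ b, r b = b → b ≠ r x₁ → b ≠ r x₂ → u ∣ (STBlock S b).ncard) →
      ∀ x, u ∣ (STBlock S x).ncard := by
    intro u hu₁ hu₂ hu x
    rw [← hβr]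
    by_cases h : r x = r x₁
    · rwa [h, hβr]
    by_cases h' : r x = r x₂
    · rwa [h', hβr]
    exact hu _ (hrr x) h h'
  rcases hN.dvd_or_dvd hNlt with hd | hd
  · refine ⟨x₂, hreps _ hd dvd_rfl fun b hb hb₁ hb₂ => ?_⟩
    obtain ⟨f₁, f₂, hf₁, hf₂, h⟩ := hbound b hb hb₁ hb₂
    have := hother b hb hb₁ hb₂
    exact CellBound.dvd_of_lt (hpos _) (hpos _) hd hN hf₂ hf₁ (by omega)
  · refine ⟨x₁, hreps _ dvd_rfl hd fun b hb hb₁ hb₂ => ?_⟩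
    obtain ⟨f₁, f₂, hf₁, hf₂, h⟩ := hbound b hb hb₁ hb₂
    have := hother b hb hb₁ hb₂
    exact CellBound.dvd_of_lt (hpos _) (hpos _) hd (cellBound_comm hN) hf₁ hf₂ (by omega)

end PartialPerm

/-- for a semitransitive subsemigroup `S` of the singular part with
`|S| ≤ 2n`, the cardinality of every transitivity block is divisible by the
minimal cardinality `t` of a transitivity block. -/
theorem stmt9 (n : ℕ) (hn : 1 ≤ n) (S : Set (ISemi n))
    (hsub : IsSubsemigroup S)
    (hsing : ∀ φ ∈ S, IsSingular φ)
    (hst : Semitransitive S)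
    (hcard : S.ncard ≤ 2 * n)
    (t : ℕ)
    (ht_le : ∀ x : Fin n, t ≤ (STBlock S x).ncard)
    (ht_ex : ∃ x : Fin n, (STBlock S x).ncard = t) :
    ∀ x : Fin n, t ∣ (STBlock S x).ncard := by
  obtain ⟨z, hz⟩ := PartialPerm.exists_dvd_blocks hn hsub hsing hst hcard
  obtain ⟨x₀, rfl⟩ := ht_ex
  have hpos : 0 < (STBlock S x₀).ncard := (Set.ncard_pos (Set.toFinite _)).2
    ⟨x₀, PartialPerm.stge_refl hst x₀, PartialPerm.stge_refl hst x₀⟩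
  rw [le_antisymm (ht_le z) (Nat.le_of_dvd hpos (hz x₀))]
  exact hz
end
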